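/- arXiv:2112.14758 — 3 statements merged into one kernel-verified Lean document; each statement's English description precedes it below -/
import Mathlib

section
/- Let k ≥ 0, d ≥ 1 be integers and s = (k+1)/d. There exists a constant c > 0 depending only on k and d such that for every N ≥ 2 with n = N^d ≥ 2, every σ > 0, and every C_n > 0, the minimax risk over the graph trend filtering class on the d-dimensional grid satisfies R( 𝒮_{n,d}^k(C_n) ) ≥ c [ σ²/n + min( σ C_n / n, σ² ) + min( (C_n/n)^{2/(2s+1)} σ^{4s/(2s+1)}, σ² ) ]. -/
open scoped BigOperators ENNReal NNReal
open MeasureTheory ProbabilityTheory Matrix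

noncomputable section

/-- Edges of the `d`-dimensional grid graph on the vertex set `{1,…,N}^d`: a
coordinate direction `j` and a vertex whose `j`-th coordinate can be increased by 1. -/
abbrev GridEdge (N d : ℕ) :=
  Σ j : Fin d, {x : Fin d → Fin N // (x j : ℕ) + 1 < N}

/-- Edge incidence matrix of the `d`-dimensional grid graph: each row has a `+1` and a
`-1` in the two columns corresponding to the endpoints of the edge. -/
def gridIncidence (N d : ℕ) : Matrix (GridEdge N d) (Fin d → Fin N) ℝ :=
  Matrix.of fun e y =>
    if y = Function.update e.2.1 e.1 ⟨(e.2.1 e.1 : ℕ) + 1, e.2.2⟩ then 1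
    else if y = e.2.1 then -1 else 0

/-- Graph Laplacian `L = DᵀD` of the `d`-dimensional grid graph. -/
def gridLaplacian (N d : ℕ) : Matrix (Fin d → Fin N) (Fin d → Fin N) ℝ :=
  (gridIncidence N d)ᵀ * gridIncidence N d

/-- Graph trend filtering penalty of order `k+1` on the grid:
`‖L^{(k+1)/2} θ‖₁` for odd `k` and `‖D L^{k/2} θ‖₁` for even `k`. -/
def gtfPenalty (N d k : ℕ) (θ : (Fin d → Fin N) → ℝ) : ℝ :=
  if k % 2 = 1 then ∑ x, |((gridLaplacian N d) ^ ((k + 1) / 2)).mulVec θ x|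
  else ∑ e, |(gridIncidence N d * (gridLaplacian N d) ^ (k / 2)).mulVec θ e|

/-- Product Gaussian measure with coordinatewise means `θ0` and variance `σ^2`. -/
def gaussSeq {ι : Type*} [Fintype ι] (θ0 : ι → ℝ) (σ : ℝ) : Measure (ι → ℝ) :=
  Measure.pi fun i => gaussianReal (θ0 i) (Real.toNNReal (σ ^ 2))

/-- Normalized expected squared error `(1/n) E‖θhat(y) - θ0‖₂²`. -/
def riskE {ι : Type*} [Fintype ι] (θhat : (ι → ℝ) → ι → ℝ) (θ0 : ι → ℝ) (σ : ℝ) : ℝ≥0∞ :=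
  (Fintype.card ι : ℝ≥0∞)⁻¹ * ∫⁻ y, ENNReal.ofReal (∑ i, (θhat y i - θ0 i) ^ 2) ∂(gaussSeq θ0 σ)

/-- Minimax risk over a parameter set `K`. -/
def minimaxRisk {ι : Type*} [Fintype ι] (K : Set (ι → ℝ)) (σ : ℝ) : ℝ≥0∞ :=
  ⨅ θhat : {f : (ι → ℝ) → ι → ℝ // Measurable f}, ⨆ θ0 ∈ K, riskE θhat.1 θ0 σ


/-- A shifted Gaussian has the usual exponential density with respect to the unshifted one. -/
lemma gaussianReal_shift_eq_withDensity (m δ : ℝ) {v : ℝ≥0} (hv : v ≠ 0) :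
    gaussianReal (m + δ) v = (gaussianReal m v).withDensity
      (fun x => ENNReal.ofReal (Real.exp (((x - m) * δ - δ ^ 2 / 2) / v))) := by
  have hv' : (v : ℝ) ≠ 0 := by exact_mod_cast hv
  rw [gaussianReal_of_var_ne_zero _ hv, gaussianReal_of_var_ne_zero _ hv,
    ← withDensity_mul _ (measurable_gaussianPDF _ _) (by fun_prop)]
  congr 1
  ext x
  simp only [Pi.mul_apply, gaussianPDF, gaussianPDFReal]
  rw [← ENNReal.ofReal_mul (by positivity), mul_assoc (√_)⁻¹, ← Real.exp_add]
  congr 3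
  field_simp
  ring

/-- A product of probability measures with densities has the product density. -/
lemma pi_withDensity_prod {ι : Type*} [Fintype ι] {α : ι → Type*} [∀ i, MeasurableSpace (α i)]
    (μ : ∀ i, Measure (α i)) [∀ i, IsProbabilityMeasure (μ i)] {f : ∀ i, α i → ℝ≥0∞}
    (hf : ∀ i, Measurable (f i)) [∀ i, SigmaFinite ((μ i).withDensity (f i))] :
    Measure.pi (fun i => (μ i).withDensity (f i)) =
      (Measure.pi μ).withDensity (fun x => ∏ i, f i (x i)) := by
  refine Measure.pi_eq fun s hs => ?_
  rw [withDensity_apply _ (MeasurableSet.univ_pi hs),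
    ← lintegral_indicator (MeasurableSet.univ_pi hs)]
  have hg : ∀ i, Measurable ((s i).indicator (f i)) := fun i => (hf i).indicator (hs i)
  have hprod : ∀ x : ∀ i, α i, (Set.univ.pi s).indicator (fun x => ∏ i, f i (x i)) x =
      ∏ i, (s i).indicator (f i) (x i) := by
    intro x
    by_cases hx : x ∈ Set.univ.pi s
    · rw [Set.indicator_of_mem hx]
      exact Finset.prod_congr rfl fun i _ =>
        (Set.indicator_of_mem (hx i (Set.mem_univ i)) _).symm
    · rw [Set.indicator_of_notMem hx]
      simp only [Set.mem_pi, Set.mem_univ, true_implies, not_forall] at hx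
      obtain ⟨i, hi⟩ := hx
      exact (Finset.prod_eq_zero (Finset.mem_univ i) (Set.indicator_of_notMem hi _)).symm
  simp_rw [hprod]
  rw [lintegral_prod_eq_prod_lintegral_of_indepFun Finset.univ
    (fun i (x : ∀ i, α i) => (s i).indicator (f i) (x i))
    (iIndepFun_pi fun i => (hg i).aemeasurable)
    (fun i => (hg i).comp (measurable_pi_apply i))]
  refine Finset.prod_congr rfl fun i _ => ?_
  rw [(measurePreserving_eval μ i).lintegral_comp (hg i), lintegral_indicator (hs i),
    withDensity_apply _ (hs i)]

section GaussSeq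

variable {ι : Type*} [Fintype ι]

instance (θ : ι → ℝ) (σ : ℝ) : IsProbabilityMeasure (gaussSeq θ σ) := by
  unfold gaussSeq; infer_instance

/-- The log-likelihood ratio of a Gaussian sequence with shifted mean. -/
def gaussLLR (θ δ : ι → ℝ) (σ : ℝ) (y : ι → ℝ) : ℝ :=
  ∑ i, ((y i - θ i) * δ i - δ i ^ 2 / 2) / σ ^ 2

lemma measurable_gaussLLR (θ δ : ι → ℝ) (σ : ℝ) : Measurable (gaussLLR θ δ σ) := by
  unfold gaussLLR; fun_prop

lemma gaussSeq_shift (θ δ : ι → ℝ) {σ : ℝ} (hσ : 0 < σ) :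
    gaussSeq (θ + δ) σ = (gaussSeq θ σ).withDensity
      (fun y => ENNReal.ofReal (Real.exp (gaussLLR θ δ σ y))) := by
  have hv : Real.toNNReal (σ ^ 2) ≠ 0 := by simp; positivity
  have hmeas : ∀ i, Measurable (fun x => ENNReal.ofReal
      (Real.exp (((x - θ i) * δ i - δ i ^ 2 / 2) / Real.toNNReal (σ ^ 2)))) := by
    intro i; fun_prop
  have hsf : ∀ i, SigmaFinite ((gaussianReal (θ i) (Real.toNNReal (σ ^ 2))).withDensity
      (fun x => ENNReal.ofReal
        (Real.exp (((x - θ i) * δ i - δ i ^ 2 / 2) / Real.toNNReal (σ ^ 2))))) := by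
    intro i
    rw [← gaussianReal_shift_eq_withDensity _ _ hv]
    infer_instance
  unfold gaussSeq
  simp only [Pi.add_apply, gaussianReal_shift_eq_withDensity _ _ hv]
  rw [pi_withDensity_prod _ hmeas]
  congr 1
  ext y
  rw [← ENNReal.ofReal_prod_of_nonneg (fun i _ => (Real.exp_pos _).le), ← Real.exp_sum,
    Real.coe_toNNReal _ (sq_nonneg σ)]
  rfl

lemma gaussLLR_add_gaussLLR_neg (θ δ : ι → ℝ) (σ : ℝ) (y : ι → ℝ) :
    gaussLLR θ δ σ y + gaussLLR θ (-δ) σ y = -((∑ i, δ i ^ 2) / σ ^ 2) := by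
  unfold gaussLLR
  rw [← Finset.sum_add_distrib, Finset.sum_div, ← Finset.sum_neg_distrib]
  refine Finset.sum_congr rfl fun i _ => ?_
  simp only [Pi.neg_apply]
  ring

/-- Two Gaussian sequence models at distance at most `2σ/√7` overlap in mass at least `1/2`. -/
lemma half_le_lintegral_min (θ δ : ι → ℝ) {σ : ℝ} (hσ : 0 < σ)
    (hδ : ∑ i, δ i ^ 2 ≤ σ ^ 2 / 7) :
    1 / 2 ≤ ∫⁻ y, min (ENNReal.ofReal (Real.exp (gaussLLR θ δ σ y)))
      (ENNReal.ofReal (Real.exp (gaussLLR θ (-δ) σ y))) ∂(gaussSeq θ σ) := by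
  set μ := gaussSeq θ σ
  set p := fun y => ENNReal.ofReal (Real.exp (gaussLLR θ δ σ y))
  set q := fun y => ENNReal.ofReal (Real.exp (gaussLLR θ (-δ) σ y))
  have hp : Measurable p := by
    have := measurable_gaussLLR θ δ σ
    fun_prop
  have hq : Measurable q := by
    have := measurable_gaussLLR θ (-δ) σ
    fun_prop
  have mass : ∀ δ' : ι → ℝ,
      ∫⁻ y, ENNReal.ofReal (Real.exp (gaussLLR θ δ' σ y)) ∂μ = 1 := by
    intro δ'
    have := measure_univ (μ := gaussSeq (θ + δ') σ)
    rwa [gaussSeq_shift θ δ' hσ, withDensity_apply _ MeasurableSet.univ,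
      Measure.restrict_univ] at this
  have hpt : ∀ y, ENNReal.ofReal (9 / 2) ≤ min (p y) (q y) + (2 * p y + 2 * q y) := by
    intro y
    have hsum := gaussLLR_add_gaussLLR_neg θ δ σ y
    set a := gaussLLR θ δ σ y
    set b := gaussLLR θ (-δ) σ y
    have hr : (∑ i, δ i ^ 2) / σ ^ 2 ≤ 1 / 7 := by
      rw [div_le_iff₀ (by positivity)]; linarith
    have hab : 6 / 7 ≤ Real.exp a * Real.exp b := by
      rw [← Real.exp_add, hsum]
      have := Real.add_one_le_exp (-((∑ i, δ i ^ 2) / σ ^ 2))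
      linarith
    have ha := Real.exp_pos a
    have hb := Real.exp_pos b
    have h2 : (2 : ℝ≥0∞) = ENNReal.ofReal 2 := by simp
    simp only [p, q]
    rw [← ENNReal.ofReal_min, h2, ← ENNReal.ofReal_mul (by norm_num),
      ← ENNReal.ofReal_mul (by norm_num), ← ENNReal.ofReal_add (by positivity) (by positivity),
      ← ENNReal.ofReal_add (by positivity) (by positivity)]
    apply ENNReal.ofReal_le_ofReal
    rcases le_total (Real.exp a) (Real.exp b) with h | h
    · rw [min_eq_left h]
      nlinarith [sq_nonneg (3 * Real.exp a - 2 * Real.exp b)]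
    · rw [min_eq_right h]
      nlinarith [sq_nonneg (3 * Real.exp b - 2 * Real.exp a)]
  have hint := lintegral_mono (μ := μ) hpt
  rw [lintegral_const, measure_univ, mul_one, lintegral_add_left (hp.min hq),
    lintegral_add_left (by fun_prop), lintegral_const_mul _ hp, lintegral_const_mul _ hq,
    mass, mass] at hint
  have h4 : (2 * 1 + 2 * 1 : ℝ≥0∞) = ENNReal.ofReal 4 := by norm_num
  rw [h4] at hint
  have := tsub_le_iff_right.mpr hint
  rw [← ENNReal.ofReal_sub _ (by norm_num)] at this
  refine le_trans ?_ this
  rw [show (9 / 2 - 4 : ℝ) = 1 / 2 by norm_num, ENNReal.ofReal_div_of_pos (by norm_num)]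
  simp

/-- Le Cam's two-point bound for a real-valued statistic. -/
lemma two_point_bound (θ δ : ι → ℝ) {σ : ℝ} (hσ : 0 < σ)
    (hδ : ∑ i, δ i ^ 2 ≤ σ ^ 2 / 7) {T : (ι → ℝ) → ℝ} (hT : Measurable T) (a : ℝ) :
    ENNReal.ofReal (a ^ 2) ≤
      ∫⁻ y, ENNReal.ofReal ((T y - a) ^ 2) ∂(gaussSeq (θ + δ) σ) +
      ∫⁻ y, ENNReal.ofReal ((T y + a) ^ 2) ∂(gaussSeq (θ + -δ) σ) := by
  have h1 := measurable_gaussLLR θ δ σ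
  have h2 := measurable_gaussLLR θ (-δ) σ
  rw [gaussSeq_shift θ δ hσ, gaussSeq_shift θ (-δ) hσ,
    lintegral_withDensity_eq_lintegral_mul _ (by fun_prop) (by fun_prop),
    lintegral_withDensity_eq_lintegral_mul _ (by fun_prop) (by fun_prop),
    ← lintegral_add_left (by fun_prop)]
  calc ENNReal.ofReal (a ^ 2) = ENNReal.ofReal (2 * a ^ 2) * (1 / 2) := by
        rw [mul_comm 2, ENNReal.ofReal_mul (by positivity), mul_assoc]
        simp [ENNReal.mul_inv_cancel]
    _ ≤ ENNReal.ofReal (2 * a ^ 2) * ∫⁻ y, min (ENNReal.ofReal (Real.exp (gaussLLR θ δ σ y)))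
          (ENNReal.ofReal (Real.exp (gaussLLR θ (-δ) σ y))) ∂(gaussSeq θ σ) := by
        gcongr
        exact half_le_lintegral_min θ δ hσ hδ
    _ = ∫⁻ y, ENNReal.ofReal (2 * a ^ 2) * min (ENNReal.ofReal (Real.exp (gaussLLR θ δ σ y)))
          (ENNReal.ofReal (Real.exp (gaussLLR θ (-δ) σ y))) ∂(gaussSeq θ σ) := by
        rw [lintegral_const_mul _ (by fun_prop)]
    _ ≤ _ := by
        refine lintegral_mono fun y => ?_
        simp only [Pi.mul_apply]
        rw [← ENNReal.ofReal_min, ← ENNReal.ofReal_mul (by positivity),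
          ← ENNReal.ofReal_mul (by positivity), ← ENNReal.ofReal_mul (by positivity),
          ← ENNReal.ofReal_add (by positivity) (by positivity)]
        apply ENNReal.ofReal_le_ofReal
        set r := min (Real.exp (gaussLLR θ δ σ y)) (Real.exp (gaussLLR θ (-δ) σ y)) with hr
        have hr0 : 0 ≤ r := le_min (Real.exp_pos _).le (Real.exp_pos _).le
        calc 2 * a ^ 2 * r ≤ r * (T y - a) ^ 2 + r * (T y + a) ^ 2 := by
              nlinarith [mul_nonneg hr0 (sq_nonneg (T y))]
          _ ≤ _ := by
              gcongr
              · exact min_le_left _ _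
              · exact min_le_right _ _

/-- Assouad's lemma for a Gaussian sequence model and a cube spanned by an orthonormal family. -/
lemma minimaxRisk_ge_of_cube {J : Type*} [Fintype J] (K : Set (ι → ℝ)) {σ τ : ℝ}
    (hσ : 0 < σ) (hτ : τ ^ 2 ≤ σ ^ 2 / 7) {u : J → EuclideanSpace ℝ ι}
    (hu : Orthonormal ℝ u)
    (hK : ∀ ε : J → ℤˣ, (fun i => ∑ j, τ * ((ε j : ℤ) : ℝ) * u j i) ∈ K) :
    ENNReal.ofReal (Fintype.card J * (τ ^ 2 / 2) / Fintype.card ι) ≤ _root_.minimaxRisk K σ := by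
  classical
  unfold _root_.minimaxRisk
  refine le_iInf fun ⟨f, hf⟩ => ?_
  set θ : (J → ℤˣ) → ι → ℝ := fun ε i => ∑ j, τ * ((ε j : ℤ) : ℝ) * u j i with hθ
  set S := ⨆ θ0 ∈ K, riskE f θ0 σ
  have hS : ∀ ε, riskE f (θ ε) σ ≤ S := fun ε => le_iSup₂_of_le (θ ε) (hK ε) le_rfl
  set T : J → (ι → ℝ) → ℝ := fun j y => ∑ i, f y i * u j i with hTdef
  have hTm : ∀ j, Measurable (T j) := fun j => by
    have : ∀ i, Measurable fun y => f y i := fun i => (measurable_pi_apply i).comp hf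
    exact Finset.measurable_sum _ fun i _ => (this i).mul_const _
  have hite := orthonormal_iff_ite.mp hu
  have hinner : ∀ a b, ∑ i, u a i * u b i = if a = b then 1 else 0 := by
    intro a b
    rw [← hite a b, PiLp.inner_apply]
    exact Finset.sum_congr rfl fun i _ => by simp [mul_comm]
  have hθu : ∀ ε j, ∑ i, θ ε i * u j i = τ * ((ε j : ℤ) : ℝ) := by
    intro ε j
    simp only [hθ, Finset.sum_mul]
    rw [Finset.sum_comm]
    simp_rw [mul_assoc, ← Finset.mul_sum, hinner]
    simp
  have hbessel : ∀ ε y, ∑ j, (T j y - τ * ((ε j : ℤ) : ℝ)) ^ 2 ≤ ∑ i, (f y i - θ ε i) ^ 2 := by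
    intro ε y
    have := hu.sum_inner_products_le (WithLp.toLp 2 (fun i => f y i - θ ε i)) (s := Finset.univ)
    rw [EuclideanSpace.norm_sq_eq] at this
    simp only [Real.norm_eq_abs, sq_abs] at this
    convert this using 2 with j _
    rw [← hθu, hTdef, PiLp.inner_apply, ← Finset.sum_sub_distrib]
    congr 1
    exact Finset.sum_congr rfl fun i _ => by simp; ring
  set F : (J → ℤˣ) → J → ℝ≥0∞ := fun ε j =>
    ∫⁻ y, ENNReal.ofReal ((T j y - τ * ((ε j : ℤ) : ℝ)) ^ 2) ∂(gaussSeq (θ ε) σ) with hF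
  have hrisk : ∀ ε, (Fintype.card ι : ℝ≥0∞)⁻¹ * ∑ j, F ε j ≤ S := by
    intro ε
    refine le_trans ?_ (hS ε)
    unfold riskE
    gcongr
    simp only [hF]
    rw [← lintegral_finsetSum' _ (fun j _ => by have := hTm j; fun_prop)]
    refine lintegral_mono fun y => ?_
    rw [← ENNReal.ofReal_sum_of_nonneg (fun j _ => sq_nonneg _)]
    exact ENNReal.ofReal_le_ofReal (hbessel ε y)
  set flip : J → (J → ℤˣ) → (J → ℤˣ) := fun j ε => Function.update ε j (-ε j) with hflip
  have hinv : ∀ j, Function.Involutive (flip j) := by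
    intro j ε
    simp [hflip]
  have hpair : ∀ ε j, ENNReal.ofReal (τ ^ 2) ≤ F ε j + F (flip j ε) j := by
    intro ε j
    have hs : (((ε j : ℤ) : ℝ)) ^ 2 = 1 := by
      rcases Int.units_eq_one_or (ε j) with h | h <;> simp [h]
    set δ : ι → ℝ := fun i => τ * ((ε j : ℤ) : ℝ) * u j i with hδdef
    have hδ : ∑ i, δ i ^ 2 ≤ σ ^ 2 / 7 := by
      have h1 := hinner j j
      have : ∑ i, δ i ^ 2 = τ ^ 2 * (((ε j : ℤ) : ℝ)) ^ 2 * ∑ i, u j i * u j i := by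
        rw [Finset.mul_sum]
        exact Finset.sum_congr rfl fun i _ => by simp only [hδdef]; ring
      rw [this, hs, h1]
      simpa using hτ
    have hdiff : θ (flip j ε) = (θ ε - δ) + -δ := by
      ext i
      simp only [hθ, hδdef, Pi.add_apply, Pi.sub_apply, Pi.neg_apply]
      rw [← Finset.add_sum_erase _ _ (Finset.mem_univ j),
        ← Finset.add_sum_erase _ (fun x => τ * ((ε x : ℤ) : ℝ) * u x i) (Finset.mem_univ j)]
      have : ∀ x ∈ Finset.univ.erase j, τ * ((flip j ε x : ℤ) : ℝ) * u x i =
          τ * ((ε x : ℤ) : ℝ) * u x i := by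
        intro x hx
        rw [hflip]
        simp [Function.update_of_ne (Finset.ne_of_mem_erase hx)]
      rw [Finset.sum_congr rfl this]
      simp [hflip]
      ring
    have := two_point_bound (θ ε - δ) δ hσ hδ (hTm j) (τ * ((ε j : ℤ) : ℝ))
    rw [← hdiff, sub_add_cancel, mul_pow, hs, mul_one] at this
    refine this.trans (le_of_eq ?_)
    simp [hF, hflip]
  have hcard : (Fintype.card (J → ℤˣ) : ℝ≥0∞) ≠ 0 := by simp
  have hsumle : (Fintype.card ι : ℝ≥0∞)⁻¹ * ∑ ε, ∑ j, F ε j ≤ Fintype.card (J → ℤˣ) * S := by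
    rw [Finset.mul_sum]
    refine (Finset.sum_le_card_nsmul _ _ S fun ε _ => hrisk ε).trans ?_
    simp [Finset.card_univ]
  have hsumge : (Fintype.card (J → ℤˣ) : ℝ≥0∞) * (Fintype.card J * ENNReal.ofReal (τ ^ 2)) ≤
      2 * ∑ ε, ∑ j, F ε j := by
    have hdouble : ∑ ε, ∑ j, (F ε j + F (flip j ε) j) = 2 * ∑ ε, ∑ j, F ε j := by
      simp_rw [Finset.sum_add_distrib]
      rw [two_mul]
      congr 1
      rw [Finset.sum_comm, Finset.sum_comm (f := fun ε j => F ε j)]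
      refine Finset.sum_congr rfl fun j _ => ?_
      exact Equiv.sum_comp (hinv j).toPerm (fun ε => F ε j)
    rw [← hdouble]
    calc _ = ∑ ε : J → ℤˣ, ∑ j : J, ENNReal.ofReal (τ ^ 2) := by
          simp [Finset.card_univ]
      _ ≤ _ := Finset.sum_le_sum fun ε _ => Finset.sum_le_sum fun j _ => hpair ε j
  rcases Nat.eq_zero_or_pos (Fintype.card ι) with hι | hι
  · simp [hι]
  have hι' : (0 : ℝ) < Fintype.card ι := by exact_mod_cast hι
  have key : (Fintype.card (J → ℤˣ) : ℝ≥0∞) *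
      ((Fintype.card ι : ℝ≥0∞)⁻¹ * (Fintype.card J * ENNReal.ofReal (τ ^ 2))) ≤
      Fintype.card (J → ℤˣ) * (2 * S) := by
    calc _ = (Fintype.card ι : ℝ≥0∞)⁻¹ *
          (Fintype.card (J → ℤˣ) * (Fintype.card J * ENNReal.ofReal (τ ^ 2))) := by ring
      _ ≤ (Fintype.card ι : ℝ≥0∞)⁻¹ * (2 * ∑ ε, ∑ j, F ε j) := by gcongr
      _ = 2 * ((Fintype.card ι : ℝ≥0∞)⁻¹ * ∑ ε, ∑ j, F ε j) := by ring
      _ ≤ 2 * (Fintype.card (J → ℤˣ) * S) := by gcongr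
      _ = _ := by ring
  rw [ENNReal.mul_le_mul_iff_right hcard (ENNReal.natCast_ne_top _)] at key
  have : ENNReal.ofReal (Fintype.card J * (τ ^ 2 / 2) / Fintype.card ι) =
      2⁻¹ * ((Fintype.card ι : ℝ≥0∞)⁻¹ * (Fintype.card J * ENNReal.ofReal (τ ^ 2))) := by
    rw [show (Fintype.card J * (τ ^ 2 / 2) / Fintype.card ι : ℝ) =
      2⁻¹ * ((Fintype.card ι : ℝ)⁻¹ * (Fintype.card J * τ ^ 2)) by field_simp,
      ENNReal.ofReal_mul (by norm_num), ENNReal.ofReal_mul (by positivity),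
      ENNReal.ofReal_mul (by positivity), ENNReal.ofReal_inv_of_pos hι',
      ENNReal.ofReal_inv_of_pos (by norm_num)]
    simp
  rw [this]
  calc _ ≤ 2⁻¹ * (2 * S) := by gcongr
    _ = S := by
      rw [← mul_assoc, ENNReal.inv_mul_cancel (by norm_num) (by norm_num), one_mul]

end GaussSeq

section Incidence

variable {N d : ℕ}

lemma gridIncidence_apply (e : GridEdge N d) (y : Fin d → Fin N) :
    gridIncidence N d e y =
      (if y = Function.update e.2.1 e.1 ⟨(e.2.1 e.1 : ℕ) + 1, e.2.2⟩ then 1 else 0) -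
        (if y = e.2.1 then 1 else 0) := by
  have hne : Function.update e.2.1 e.1 ⟨(e.2.1 e.1 : ℕ) + 1, e.2.2⟩ ≠ e.2.1 := by
    intro h
    have := congrFun h e.1
    simp [Fin.ext_iff] at this
  unfold gridIncidence
  simp only [Matrix.of_apply]
  by_cases h1 : y = Function.update e.2.1 e.1 ⟨(e.2.1 e.1 : ℕ) + 1, e.2.2⟩
  · have h2 : y ≠ e.2.1 := h1 ▸ hne
    rw [if_pos h1, if_pos h1, if_neg h2, sub_zero]
  · rw [if_neg h1, if_neg h1]
    split_ifs <;> simp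

lemma gridIncidence_mulVec (θ : (Fin d → Fin N) → ℝ) (e : GridEdge N d) :
    (gridIncidence N d).mulVec θ e =
      θ (Function.update e.2.1 e.1 ⟨(e.2.1 e.1 : ℕ) + 1, e.2.2⟩) - θ e.2.1 := by
  simp [Matrix.mulVec, dotProduct, gridIncidence_apply, sub_mul, Finset.sum_sub_distrib]

/-- The grid divergence, written as a sum over coordinate directions. -/
lemma gridIncidence_transpose_mulVec (w : GridEdge N d → ℝ) (x : Fin d → Fin N) :
    (gridIncidence N d)ᵀ.mulVec w x = ∑ j : Fin d,
      ((if h : 0 < (x j : ℕ) then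
          w ⟨j, Function.update x j ⟨(x j : ℕ) - 1, by omega⟩, by simp; omega⟩ else 0) -
        (if h : (x j : ℕ) + 1 < N then w ⟨j, x, h⟩ else 0)) := by
  simp only [Matrix.mulVec, dotProduct, Matrix.transpose_apply, gridIncidence_apply]
  rw [Fintype.sum_sigma]
  refine Finset.sum_congr rfl fun j _ => ?_
  simp only [sub_mul, Finset.sum_sub_distrib]
  congr 1
  · split_ifs with h
    · rw [Finset.sum_eq_single
        (⟨Function.update x j ⟨(x j : ℕ) - 1, by omega⟩, by simp; omega⟩ :
          {x : Fin d → Fin N // (x j : ℕ) + 1 < N})]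
      · have : x = Function.update (Function.update x j ⟨(x j : ℕ) - 1, by omega⟩) j
            ⟨(Function.update x j (⟨(x j : ℕ) - 1, by omega⟩ : Fin N) j : ℕ) + 1,
              by simp; omega⟩ := by
          ext i
          by_cases hi : i = j
          · subst hi; simp; omega
          · simp [hi]
        rw [if_pos this, one_mul]
      · intro b _ hb
        rw [if_neg, zero_mul]
        intro hx
        apply hb
        ext i
        by_cases hi : i = j
        · subst hi
          have := congrFun hx i
          simp [Fin.ext_iff] at this
          simp; omega
        · have := congrFun hx i
          simp [hi] at this
          simp [hi, this]
      · simp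
    · refine Finset.sum_eq_zero fun b _ => ?_
      rw [if_neg, zero_mul]
      intro hx
      have := congrFun hx j
      simp [Fin.ext_iff] at this
      omega
  · split_ifs with h
    · rw [Finset.sum_eq_single (⟨x, h⟩ : {x : Fin d → Fin N // (x j : ℕ) + 1 < N})]
      · simp
      · intro b _ hb
        rw [if_neg, zero_mul]
        intro hx
        exact hb (Subtype.ext hx.symm)
      · simp
    · refine Finset.sum_eq_zero fun b _ => ?_
      rw [if_neg, zero_mul]
      intro hx
      apply h
      rw [hx]
      exact b.2

lemma card_gridEdge_le : Fintype.card (GridEdge N d) ≤ d * N ^ d := by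
  rw [Fintype.card_sigma]
  calc _ ≤ ∑ _j : Fin d, N ^ d := by
        refine Finset.sum_le_sum fun j _ => ?_
        refine (Fintype.card_subtype_le _).trans (le_of_eq ?_)
        simp
    _ = d * N ^ d := by simp

lemma sum_comp_le_sum_of_injective {α β : Type*} [Fintype α] [Fintype β] {f : α → β}
    (hf : Function.Injective f) {g : β → ℝ} (hg : ∀ b, 0 ≤ g b) : ∑ a, g (f a) ≤ ∑ b, g b := by
  have := Finset.sum_map Finset.univ ⟨f, hf⟩ g
  simp only [Function.Embedding.coeFn_mk] at this
  rw [← this]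
  exact Finset.sum_le_univ_sum_of_nonneg hg

lemma sum_abs_gridIncidence_mulVec_le (θ : (Fin d → Fin N) → ℝ) :
    ∑ e, |(gridIncidence N d).mulVec θ e| ≤ 2 * d * ∑ x, |θ x| := by
  simp only [gridIncidence_mulVec]
  rw [Fintype.sum_sigma]
  calc _ ≤ ∑ _j : Fin d, (∑ x, |θ x| + ∑ x, |θ x|) := by
        refine Finset.sum_le_sum fun j _ => ?_
        refine (Finset.sum_le_sum fun x _ => abs_sub _ _).trans ?_
        rw [Finset.sum_add_distrib]
        gcongr
        · refine sum_comp_le_sum_of_injective (g := fun x => |θ x|)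
            (f := fun x : {x : Fin d → Fin N // (x j : ℕ) + 1 < N} =>
              Function.update x.1 j ⟨(x.1 j : ℕ) + 1, x.2⟩) ?_ (fun _ => abs_nonneg _)
          intro a b hab
          ext i
          have := congrFun hab i
          by_cases hi : i = j
          · subst hi; simpa using this
          · simp [hi] at this
            simp [this]
        · exact sum_comp_le_sum_of_injective (g := fun x => |θ x|)
            Subtype.val_injective (fun _ => abs_nonneg _)
    _ = _ := by simp; ring

lemma sum_abs_gridIncidence_transpose_mulVec_le (w : GridEdge N d → ℝ) :
    ∑ x, |(gridIncidence N d)ᵀ.mulVec w x| ≤ 2 * ∑ e, |w e| := by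
  calc _ ≤ ∑ x, ∑ e, |gridIncidence N d e x| * |w e| := by
        refine Finset.sum_le_sum fun x _ => ?_
        refine (Finset.abs_sum_le_sum_abs _ _).trans (le_of_eq ?_)
        exact Finset.sum_congr rfl fun e _ => abs_mul _ _
    _ = ∑ e, (∑ x, |gridIncidence N d e x|) * |w e| := by
        rw [Finset.sum_comm]
        simp_rw [Finset.sum_mul]
    _ ≤ ∑ e, 2 * |w e| := by
        refine Finset.sum_le_sum fun e _ => ?_
        gcongr
        simp only [gridIncidence_apply]
        refine (Finset.sum_le_sum fun x _ => abs_sub _ _).trans ?_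
        rw [Finset.sum_add_distrib]
        simp only [apply_ite abs, abs_one, abs_zero, Finset.sum_ite_eq', Finset.mem_univ, if_true]
        norm_num
    _ = _ := by rw [Finset.mul_sum]

lemma sum_abs_gridLaplacian_pow_mulVec_le (p : ℕ) (θ : (Fin d → Fin N) → ℝ) :
    ∑ x, |(gridLaplacian N d ^ p).mulVec θ x| ≤ (4 * d) ^ p * ∑ x, |θ x| := by
  induction p with
  | zero => simp
  | succ p ih =>
    rw [pow_succ' (gridLaplacian N d), ← Matrix.mulVec_mulVec]
    set w := (gridLaplacian N d ^ p).mulVec θ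
    rw [gridLaplacian, ← Matrix.mulVec_mulVec]
    refine (sum_abs_gridIncidence_transpose_mulVec_le _).trans ?_
    calc _ ≤ 2 * (2 * d * ∑ x, |w x|) := by
          gcongr; exact sum_abs_gridIncidence_mulVec_le w
      _ ≤ 2 * (2 * d * ((4 * d) ^ p * ∑ x, |θ x|)) := by gcongr
      _ = _ := by ring

/-- The trend filtering penalty is controlled by the `ℓ¹` norm. -/
lemma gtfPenalty_le_sum_abs (hd : 1 ≤ d) (k : ℕ) (θ : (Fin d → Fin N) → ℝ) :
    gtfPenalty N d k θ ≤ (4 * d) ^ (k + 1) * ∑ x, |θ x| := by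
  have hd' : (1 : ℝ) ≤ d := by exact_mod_cast hd
  have h0 : 0 ≤ ∑ x, |θ x| := Finset.sum_nonneg fun _ _ => abs_nonneg _
  unfold gtfPenalty
  split_ifs with hk
  · refine (sum_abs_gridLaplacian_pow_mulVec_le _ θ).trans ?_
    gcongr
    · linarith
    · omega
  · simp_rw [← Matrix.mulVec_mulVec]
    refine (sum_abs_gridIncidence_mulVec_le _).trans ?_
    calc _ ≤ 2 * d * ((4 * d) ^ (k / 2) * ∑ x, |θ x|) := by
          gcongr; exact sum_abs_gridLaplacian_pow_mulVec_le _ θ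
      _ ≤ (4 * d) * ((4 * d) ^ (k / 2) * ∑ x, |θ x|) := by gcongr; norm_num
      _ = (4 * d) ^ (k / 2 + 1) * ∑ x, |θ x| := by ring
      _ ≤ _ := by
        gcongr
        · linarith
        · omega

end Incidence

section Spectral

variable {N d : ℕ} {J : Type*} [Fintype J]

lemma sum_mul_of_orthonormal {V : Type*} [Fintype V] {u : J → EuclideanSpace ℝ V}
    (hu : Orthonormal ℝ u) (a b : J → ℝ) :
    ∑ x, (∑ j, a j * u j x) * (∑ j, b j * u j x) = ∑ j, a j * b j := by
  have := hu.inner_sum a b Finset.univ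
  rw [PiLp.inner_apply] at this
  simp only [conj_trivial] at this
  rw [← this]
  refine Finset.sum_congr rfl fun x _ => ?_
  simp [mul_comm]

lemma gridLaplacian_pow_mulVec_sum {u : J → EuclideanSpace ℝ (Fin d → Fin N)} {lam : J → ℝ}
    (hL : ∀ j, (gridLaplacian N d).mulVec (fun x => u j x) = fun x => lam j * u j x)
    (c : J → ℝ) (p : ℕ) :
    (gridLaplacian N d ^ p).mulVec (fun x => ∑ j, c j * u j x) =
      fun x => ∑ j, (c j * lam j ^ p) * u j x := by
  induction p with
  | zero => simp
  | succ p ih =>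
    rw [pow_succ', ← Matrix.mulVec_mulVec, ih]
    have : (fun x => ∑ j, (c j * lam j ^ p) * u j x) =
        ∑ j, (c j * lam j ^ p) • (fun x => u j x) := by
      ext x; simp
    rw [this, Matrix.mulVec_sum]
    simp_rw [Matrix.mulVec_smul, hL]
    ext x
    simp only [Finset.sum_apply, Pi.smul_apply, smul_eq_mul]
    exact Finset.sum_congr rfl fun j _ => by ring

/-- On combinations of orthonormal Laplacian eigenvectors the trend filtering penalty is
controlled by the spectral Sobolev norm. -/
lemma gtfPenalty_sq_le_of_eigenvectors (hd : 1 ≤ d) (k : ℕ)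
    {u : J → EuclideanSpace ℝ (Fin d → Fin N)} (hu : Orthonormal ℝ u) {lam : J → ℝ}
    (hL : ∀ j, (gridLaplacian N d).mulVec (fun x => u j x) = fun x => lam j * u j x)
    (c : J → ℝ) :
    gtfPenalty N d k (fun x => ∑ j, c j * u j x) ^ 2 ≤
      d * N ^ d * ∑ j, c j ^ 2 * lam j ^ (k + 1) := by
  have hd' : (1 : ℝ) ≤ d := by exact_mod_cast hd
  unfold gtfPenalty
  split_ifs with hk
  · refine sq_sum_le_card_mul_sum_sq.trans ?_
    simp only [sq_abs]
    rw [gridLaplacian_pow_mulVec_sum hL]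
    have h := sum_mul_of_orthonormal hu (fun j => c j * lam j ^ ((k + 1) / 2))
      (fun j => c j * lam j ^ ((k + 1) / 2))
    simp_rw [← sq] at h
    rw [h]
    have he : ∀ j, (c j * lam j ^ ((k + 1) / 2)) ^ 2 = c j ^ 2 * lam j ^ (k + 1) := by
      intro j
      rw [mul_pow, ← pow_mul]
      congr 2
      omega
    simp_rw [he]
    have h0 : 0 ≤ ∑ j, c j ^ 2 * lam j ^ (k + 1) := by
      simp_rw [← he]
      positivity
    gcongr
    rw [Finset.card_univ]
    simp only [Fintype.card_pi, Fintype.card_fin, Finset.prod_const, Finset.card_univ]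
    push_cast
    nlinarith [pow_nonneg (Nat.cast_nonneg (α := ℝ) N) d]
  · refine sq_sum_le_card_mul_sum_sq.trans ?_
    simp only [sq_abs]
    have h2 : ∑ e, (gridIncidence N d * gridLaplacian N d ^ (k / 2)).mulVec
        (fun x => ∑ j, c j * u j x) e ^ 2 = ∑ j, c j ^ 2 * lam j ^ (k + 1) := by
      rw [← Matrix.mulVec_mulVec, gridLaplacian_pow_mulVec_sum hL]
      set a : J → ℝ := fun j => c j * lam j ^ (k / 2)
      set w : (Fin d → Fin N) → ℝ := fun x => ∑ j, a j * u j x with hw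
      have hquad : ∑ e, (gridIncidence N d).mulVec w e ^ 2 =
          w ⬝ᵥ (gridLaplacian N d).mulVec w := by
        rw [gridLaplacian, ← Matrix.mulVec_mulVec, Matrix.dotProduct_mulVec,
          Matrix.vecMul_transpose]
        simp [dotProduct, sq]
      have hLw := gridLaplacian_pow_mulVec_sum hL a 1
      rw [pow_one] at hLw
      rw [hquad, hw, hLw]
      simp only [dotProduct]
      rw [sum_mul_of_orthonormal hu]
      refine Finset.sum_congr rfl fun j _ => ?_
      have : k + 1 = k / 2 + k / 2 + 1 := by omega
      rw [this]
      simp only [a]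
      ring
    rw [h2]
    have h0 : 0 ≤ ∑ j, c j ^ 2 * lam j ^ (k + 1) := by
      rw [← h2]; positivity
    gcongr
    exact_mod_cast card_gridEdge_le

end Spectral

section Cosine

/-- The `a`-th Neumann cosine mode on a path with `N` vertices, extended to the real line. -/
def pathCos (N a : ℕ) (s : ℝ) : ℝ := Real.cos (Real.pi * a / N * (s + 1 / 2))

/-- The Laplacian eigenvalue of the `a`-th cosine mode. -/
def pathEig (N a : ℕ) : ℝ := 2 - 2 * Real.cos (Real.pi * a / N)

lemma pathCos_second_difference (N a : ℕ) (s : ℝ) :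
    (pathCos N a s - pathCos N a (s - 1)) - (pathCos N a (s + 1) - pathCos N a s) =
      pathEig N a * pathCos N a s := by
  unfold pathCos pathEig
  set ω := Real.pi * a / N
  rw [show ω * (s - 1 + 1 / 2) = ω * (s + 1 / 2) - ω by ring,
    show ω * (s + 1 + 1 / 2) = ω * (s + 1 / 2) + ω by ring, Real.cos_sub, Real.cos_add]
  ring

lemma pathCos_neg_one (N a : ℕ) : pathCos N a (0 - 1) = pathCos N a 0 := by
  unfold pathCos
  rw [← Real.cos_neg]
  congr 1
  ring

lemma pathCos_last {N : ℕ} (hN : 0 < N) (a : ℕ) : pathCos N a N = pathCos N a (N - 1) := by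
  have hN' : (N : ℝ) ≠ 0 := by positivity
  unfold pathCos
  set ω := Real.pi * a / N with hω
  have h : ω * N = a * Real.pi := by rw [hω]; field_simp
  rw [show ω * ((N : ℝ) + 1 / 2) = ω * N + ω / 2 by ring,
    show ω * ((N : ℝ) - 1 + 1 / 2) = ω * N - ω / 2 by ring, h, Real.cos_sub, Real.cos_add,
    Real.sin_nat_mul_pi]
  ring

lemma pathEig_nonneg (N a : ℕ) : 0 ≤ pathEig N a := by
  unfold pathEig
  linarith [Real.cos_le_one (Real.pi * a / N)]

lemma pathEig_le {N a q : ℕ} (ha : a ≤ q) : pathEig N a ≤ Real.pi ^ 2 * (q / N) ^ 2 := by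
  have h := Real.one_sub_sq_div_two_le_cos (x := Real.pi * a / N)
  have : (Real.pi * a / N) ^ 2 ≤ Real.pi ^ 2 * (q / N) ^ 2 := by
    rw [← mul_pow, mul_div_assoc]
    gcongr
  unfold pathEig
  linarith

lemma pathEig_injOn {N : ℕ} : Set.InjOn (pathEig N) {a | a < N} := by
  intro a ha b hb h
  simp only [Set.mem_ofPred_eq] at ha hb
  have hN : (0 : ℝ) < N := by exact_mod_cast (by omega : 0 < N)
  have hmem : ∀ c : ℕ, c < N → Real.pi * c / N ∈ Set.Icc 0 Real.pi := by
    intro c hc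
    refine ⟨by positivity, ?_⟩
    rw [div_le_iff₀ hN]
    have : (c : ℝ) ≤ N := by exact_mod_cast hc.le
    gcongr
  have hcos : Real.cos (Real.pi * a / N) = Real.cos (Real.pi * b / N) := by
    unfold pathEig at h; linarith
  have := Real.injOn_cos (hmem a ha) (hmem b hb) hcos
  have hpi := Real.pi_pos
  field_simp at this
  exact_mod_cast this

lemma sum_pathCos_mul_eq_zero {N a b : ℕ} (ha : a < N) (hb : b < N) (hab : a ≠ b) :
    ∑ t : Fin N, pathCos N a (t : ℕ) * pathCos N b (t : ℕ) = 0 := by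
  have hN : 0 < N := by omega
  rw [Fin.sum_univ_eq_sum_range (fun t => pathCos N a (t : ℕ) * pathCos N b (t : ℕ))]
  set W : ℕ → ℝ := fun t => pathCos N a ((t : ℝ) - 1) * pathCos N b t -
    pathCos N a t * pathCos N b ((t : ℝ) - 1) with hW
  have htel : ∀ t : ℕ, (pathEig N a - pathEig N b) * (pathCos N a t * pathCos N b t) =
      W (t + 1) - W t := by
    intro t
    have h1 := pathCos_second_difference N a t
    have h2 := pathCos_second_difference N b t
    simp only [hW]
    push_cast
    rw [add_sub_cancel_right]
    linear_combination (-pathCos N b t) * h1 + pathCos N a t * h2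
  have hsum : (pathEig N a - pathEig N b) *
      ∑ t ∈ Finset.range N, pathCos N a (t : ℕ) * pathCos N b (t : ℕ) = 0 := by
    rw [Finset.mul_sum]
    simp_rw [htel]
    rw [Finset.sum_range_sub]
    simp only [hW]
    push_cast
    rw [pathCos_neg_one, pathCos_neg_one, pathCos_last hN, pathCos_last hN]
    ring
  refine (mul_eq_zero.mp hsum).resolve_left ?_
  intro h
  exact hab (pathEig_injOn ha hb (by linarith))

lemma pathCos_zero_pos {N a : ℕ} (ha : a < N) : 0 < pathCos N a 0 := by
  have hN : (0 : ℝ) < N := by exact_mod_cast (by omega : 0 < N)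
  have ha' : (a : ℝ) < N := by exact_mod_cast ha
  unfold pathCos
  apply Real.cos_pos_of_mem_Ioo
  have hpi := Real.pi_pos
  have h0 : 0 ≤ Real.pi * a / N := by positivity
  have h1 : Real.pi * a / N < Real.pi := by
    rw [div_lt_iff₀ hN]; gcongr
  constructor <;> linarith

/-- Product of cosine modes on the grid. -/
def gridCos (N d : ℕ) (a : Fin d → ℕ) (x : Fin d → Fin N) : ℝ :=
  ∏ i, pathCos N (a i) ((x i : ℕ) : ℝ)

lemma gridCos_update {N d : ℕ} (a : Fin d → ℕ) (x : Fin d → Fin N) (j : Fin d) (t : Fin N) :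
    gridCos N d a (Function.update x j t) = pathCos N (a j) ((t : ℕ) : ℝ) *
      ∏ i ∈ Finset.univ.erase j, pathCos N (a i) ((x i : ℕ) : ℝ) := by
  unfold gridCos
  rw [← Finset.mul_prod_erase _ _ (Finset.mem_univ j), Function.update_self]
  congr 1
  refine Finset.prod_congr rfl fun i hi => ?_
  rw [Function.update_of_ne (Finset.ne_of_mem_erase hi)]

lemma gridLaplacian_mulVec_gridCos {N d : ℕ} (a : Fin d → ℕ) :
    (gridLaplacian N d).mulVec (gridCos N d a) =
      fun x => (∑ j, pathEig N (a j)) * gridCos N d a x := by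
  ext x
  rw [gridLaplacian, ← Matrix.mulVec_mulVec, gridIncidence_transpose_mulVec, Finset.sum_mul]
  refine Finset.sum_congr rfl fun j _ => ?_
  set P := ∏ i ∈ Finset.univ.erase j, pathCos N (a i) ((x i : ℕ) : ℝ) with hP
  have hx : gridCos N d a x = pathCos N (a j) ((x j : ℕ) : ℝ) * P := by
    conv_lhs => rw [← Function.update_eq_self j x]
    exact gridCos_update a x j (x j)
  have hlt := (x j).isLt
  have hback : (if h : 0 < (x j : ℕ) then (gridIncidence N d).mulVec (gridCos N d a)
      ⟨j, Function.update x j ⟨(x j : ℕ) - 1, by omega⟩, by simp; omega⟩ else 0) =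
      (pathCos N (a j) ((x j : ℕ) : ℝ) - pathCos N (a j) (((x j : ℕ) : ℝ) - 1)) * P := by
    split_ifs with h
    · rw [gridIncidence_mulVec]
      simp only [Function.update_idem, Function.update_self]
      rw [gridCos_update, gridCos_update]
      have h1 : (x j : ℕ) - 1 + 1 = (x j : ℕ) := by omega
      simp only [h1]
      rw [Nat.cast_sub (by omega)]
      push_cast
      ring
    · have h0 : (x j : ℕ) = 0 := by omega
      rw [h0, Nat.cast_zero, pathCos_neg_one]
      ring
  have hforw : (if h : (x j : ℕ) + 1 < N then (gridIncidence N d).mulVec (gridCos N d a)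
      ⟨j, x, h⟩ else 0) =
      (pathCos N (a j) (((x j : ℕ) : ℝ) + 1) - pathCos N (a j) ((x j : ℕ) : ℝ)) * P := by
    split_ifs with h
    · rw [gridIncidence_mulVec, hx]
      simp only
      rw [gridCos_update]
      push_cast
      ring
    · have h0 : (N : ℝ) = ((x j : ℕ) : ℝ) + 1 := by
        exact_mod_cast (by omega : N = (x j : ℕ) + 1)
      have := pathCos_last (by omega : 0 < N) (a j)
      rw [h0, add_sub_cancel_right] at this
      rw [this]
      ring
  rw [hback, hforw, hx, ← mul_assoc, ← pathCos_second_difference]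
  ring

lemma sum_gridCos_mul {N d : ℕ} (a b : Fin d → ℕ) :
    ∑ x, gridCos N d a x * gridCos N d b x =
      ∏ i, ∑ t : Fin N, pathCos N (a i) (t : ℕ) * pathCos N (b i) (t : ℕ) := by
  rw [Fintype.prod_sum]
  simp only [gridCos, Finset.prod_mul_distrib]

/-- There is an orthonormal family of `(q+1)^d` low-frequency Laplacian eigenvectors. -/
lemma exists_orthonormal_eigenvectors {N d q : ℕ} (hq : q < N) :
    ∃ (u : (Fin d → Fin (q + 1)) → EuclideanSpace ℝ (Fin d → Fin N))
      (lam : (Fin d → Fin (q + 1)) → ℝ), Orthonormal ℝ u ∧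
      (∀ j, (gridLaplacian N d).mulVec (fun x => u j x) = fun x => lam j * u j x) ∧
      ∀ j, 0 ≤ lam j ∧ lam j ≤ d * Real.pi ^ 2 * (q / N) ^ 2 := by
  set v : (Fin d → Fin (q + 1)) → EuclideanSpace ℝ (Fin d → Fin N) :=
    fun a => WithLp.toLp 2 (gridCos N d (fun i => a i)) with hv
  have hlt : ∀ (a : Fin d → Fin (q + 1)) i, (a i : ℕ) < N := fun a i => by
    have := (a i).isLt; omega
  have hne : ∀ a, v a ≠ 0 := by
    intro a h0
    have := congrArg (fun w : EuclideanSpace ℝ (Fin d → Fin N) => w fun _ => ⟨0, by omega⟩) h0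
    simp only [hv, gridCos, PiLp.zero_apply, Nat.cast_zero] at this
    exact (Finset.prod_pos fun i _ => pathCos_zero_pos (hlt a i)).ne' this
  have horth : ∀ a b, a ≠ b → inner ℝ (v a) (v b) = 0 := by
    intro a b hab
    obtain ⟨i, hi⟩ := Function.ne_iff.mp hab
    have h := sum_gridCos_mul (N := N) (fun i => (b i : ℕ)) (fun i => (a i : ℕ))
    rw [Finset.prod_eq_zero (Finset.mem_univ i) (sum_pathCos_mul_eq_zero (hlt b i) (hlt a i)
      (fun h => hi (Fin.ext h.symm)))] at h
    rw [PiLp.inner_apply, ← h]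
    exact Finset.sum_congr rfl fun x _ => by simp [hv]
  refine ⟨fun a => ‖v a‖⁻¹ • v a, fun a => ∑ i, pathEig N (a i), ⟨fun a => ?_, fun a b hab => ?_⟩,
    fun a => ?_, fun a => ⟨?_, ?_⟩⟩
  · rw [norm_smul, norm_inv, norm_norm, inv_mul_cancel₀ (norm_ne_zero_iff.mpr (hne a))]
  · change inner ℝ (‖v a‖⁻¹ • v a) (‖v b‖⁻¹ • v b) = 0
    rw [inner_smul_left, inner_smul_right, horth a b hab]
    simp
  · have : (fun x => (‖v a‖⁻¹ • v a) x) = ‖v a‖⁻¹ • gridCos N d (fun i => a i) := by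
      ext x; simp [hv]
    rw [this, Matrix.mulVec_smul, gridLaplacian_mulVec_gridCos]
    ext x
    simp [hv]
    ring
  · exact Finset.sum_nonneg fun i _ => pathEig_nonneg _ _
  · calc _ ≤ ∑ _i : Fin d, Real.pi ^ 2 * ((q : ℝ) / N) ^ 2 :=
          Finset.sum_le_sum fun i _ => pathEig_le (by have := (a i).isLt; omega)
      _ = _ := by simp; ring

end Cosine

section Risk

variable {N d k : ℕ} {σ C : ℝ}

/-- Lower bound from a cube spanned by `m` coordinate vectors. -/
lemma minimaxRisk_ge_of_spikes (hd : 1 ≤ d) (hσ : 0 < σ) {m : ℕ} (hm : m ≤ N ^ d)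
    (hC : (4 * d) ^ (k + 1) * (m * (σ / 3)) ≤ C) :
    ENNReal.ofReal (m * (σ ^ 2 / 18) / (N ^ d : ℕ)) ≤
      _root_.minimaxRisk {θ : (Fin d → Fin N) → ℝ | gtfPenalty N d k θ ≤ C} σ := by
  classical
  have hcard : Fintype.card (Fin m) ≤ Fintype.card (Fin d → Fin N) := by simpa using hm
  obtain ⟨g⟩ := Function.Embedding.nonempty_of_card_le hcard
  set u : Fin m → EuclideanSpace ℝ (Fin d → Fin N) := fun j => EuclideanSpace.single (g j) 1
    with hu
  have huo : Orthonormal ℝ u := (EuclideanSpace.orthonormal_single (𝕜 := ℝ)).comp g g.injective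
  have key := minimaxRisk_ge_of_cube {θ : (Fin d → Fin N) → ℝ | gtfPenalty N d k θ ≤ C} hσ
    (τ := σ / 3) (by nlinarith) huo ?_
  · convert key using 2
    simp
    ring
  · intro ε
    refine (gtfPenalty_le_sum_abs hd k _).trans (le_trans ?_ hC)
    gcongr
    calc _ ≤ ∑ x, ∑ j : Fin m, |σ / 3 * ((ε j : ℤ) : ℝ) * u j x| :=
          Finset.sum_le_sum fun x _ => Finset.abs_sum_le_sum_abs _ _
      _ = ∑ j : Fin m, ∑ x, |σ / 3 * ((ε j : ℤ) : ℝ) * u j x| := Finset.sum_comm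
      _ = ∑ j : Fin m, σ / 3 := by
          refine Finset.sum_congr rfl fun j _ => ?_
          have hs : |((ε j : ℤ) : ℝ)| = 1 := by
            rcases Int.units_eq_one_or (ε j) with h | h <;> simp [h]
          simp only [abs_mul, hs, mul_one, ← Finset.mul_sum]
          rw [abs_of_pos (by positivity)]
          simp [hu, apply_ite abs]
      _ = m * (σ / 3) := by simp

/-- Lower bound from a cube spanned by low-frequency cosine modes. -/
lemma minimaxRisk_ge_of_lowFrequency (hd : 1 ≤ d) (hσ : 0 < σ) (hC0 : 0 ≤ C) {q : ℕ} (hq : q < N)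
    (hC : d * (N : ℝ) ^ d * ((q + 1) ^ d * (σ ^ 2 *
      (d * Real.pi ^ 2 * (q / N) ^ 2) ^ (k + 1))) ≤ C ^ 2) :
    ENNReal.ofReal ((q + 1) ^ d * (σ ^ 2 / 18) / (N ^ d : ℕ)) ≤
      _root_.minimaxRisk {θ : (Fin d → Fin N) → ℝ | gtfPenalty N d k θ ≤ C} σ := by
  obtain ⟨u, lam, hu, hL, hlam⟩ := exists_orthonormal_eigenvectors (d := d) hq
  have key := minimaxRisk_ge_of_cube {θ : (Fin d → Fin N) → ℝ | gtfPenalty N d k θ ≤ C} hσ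
    (τ := σ / 3) (by nlinarith) hu ?_
  · convert key using 2
    simp
    ring
  · intro ε
    have h := gtfPenalty_sq_le_of_eigenvectors hd k hu hL (fun j => σ / 3 * ((ε j : ℤ) : ℝ))
    refine abs_le_of_sq_le_sq' (h.trans (le_trans ?_ hC)) hC0 |>.2
    gcongr
    calc _ ≤ ∑ _j : Fin d → Fin (q + 1), σ ^ 2 *
          (d * Real.pi ^ 2 * ((q : ℝ) / N) ^ 2) ^ (k + 1) := by
          refine Finset.sum_le_sum fun j _ => ?_
          have hs : ((ε j : ℤ) : ℝ) ^ 2 = 1 := by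
            rcases Int.units_eq_one_or (ε j) with h | h <;> simp [h]
          rw [mul_pow, hs, mul_one]
          have h0 := (hlam j).1
          have h1 := (hlam j).2
          gcongr
          linarith
      _ = _ := by simp

lemma one_le_pow_four_mul (hd : 1 ≤ d) : (1 : ℝ) ≤ (4 * d) ^ (k + 1) := by
  have : (1 : ℝ) ≤ d := by exact_mod_cast hd
  exact one_le_pow₀ (by linarith)

lemma minimaxRisk_ge_parametric (hd : 1 ≤ d) (hN : 0 < N) (hσ : 0 < σ) (hC0 : 0 ≤ C) :
    ENNReal.ofReal (σ ^ 2 / 18 / (N ^ d : ℕ)) ≤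
      _root_.minimaxRisk {θ : (Fin d → Fin N) → ℝ | gtfPenalty N d k θ ≤ C} σ := by
  have := minimaxRisk_ge_of_lowFrequency (k := k) hd hσ hC0 hN (by simp; positivity)
  simpa using this

lemma minimaxRisk_ge_sparse (hd : 1 ≤ d) (hN : 0 < N) (hσ : 0 < σ) (hC0 : 0 < C) :
    ENNReal.ofReal (min (σ * C / (N ^ d : ℕ)) (σ ^ 2) / (36 * (4 * d) ^ (k + 1))) ≤
      _root_.minimaxRisk {θ : (Fin d → Fin N) → ℝ | gtfPenalty N d k θ ≤ C} σ := by
  set B : ℝ := (4 * d) ^ (k + 1) with hB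
  have hB1 : 1 ≤ B := one_le_pow_four_mul hd
  have hn : (0 : ℝ) < (N ^ d : ℕ) := by positivity
  set m := min (N ^ d) ⌊C / (B * (σ / 3))⌋₊ with hm
  have hmC : B * (m * (σ / 3)) ≤ C := by
    have h1 : (m : ℝ) ≤ C / (B * (σ / 3)) :=
      le_trans (by exact_mod_cast min_le_right _ _) (Nat.floor_le (by positivity))
    rw [le_div_iff₀ (by positivity)] at h1
    linarith
  have hx : min (σ * C / (N ^ d : ℕ)) (σ ^ 2) ≤ (m + 1) * B * σ ^ 2 / (N ^ d : ℕ) := by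
    rcases le_total (N ^ d) ⌊C / (B * (σ / 3))⌋₊ with h | h
    · refine (min_le_right _ _).trans ?_
      rw [hm, min_eq_left h, le_div_iff₀ hn]
      have : ((N ^ d : ℕ) : ℝ) ≤ (((N ^ d : ℕ) : ℝ) + 1) * B := by nlinarith
      nlinarith [sq_nonneg σ]
    · refine (min_le_left _ _).trans ?_
      rw [hm, min_eq_right h]
      have h2 := Nat.lt_floor_add_one (C / (B * (σ / 3)))
      rw [div_lt_iff₀ (by positivity)] at h2
      gcongr ?_ / _
      set z : ℝ := (⌊C / (B * (σ / 3))⌋₊ : ℝ) + 1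
      have hz : 0 ≤ z := by positivity
      calc σ * C ≤ σ * (z * (B * (σ / 3))) := by gcongr
        _ = z * B * σ ^ 2 / 3 := by ring
        _ ≤ _ := by
          have : 0 ≤ z * B * σ ^ 2 := by positivity
          linarith
  have hx' : min (σ * C / (N ^ d : ℕ)) (σ ^ 2) / (36 * B) ≤
      (m + 1) / 2 * (σ ^ 2 / 18) / (N ^ d : ℕ) := by
    rw [div_le_iff₀ (by positivity)]
    refine hx.trans (le_of_eq ?_)
    ring
  refine (ENNReal.ofReal_le_ofReal hx').trans ?_
  rcases Nat.eq_zero_or_pos m with h0 | h0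
  · refine le_trans (ENNReal.ofReal_le_ofReal ?_)
      (minimaxRisk_ge_parametric hd hN hσ hC0.le)
    rw [h0]
    gcongr
    push_cast
    nlinarith [sq_nonneg σ]
  · refine le_trans (ENNReal.ofReal_le_ofReal ?_)
      (minimaxRisk_ge_of_spikes hd hσ (min_le_left _ _) hmC)
    have : (1 : ℝ) ≤ m := by exact_mod_cast h0
    gcongr
    linarith

lemma minimaxRisk_ge_of_bandwidth (hd : 1 ≤ d) (hN : 0 < N) (hσ : 0 < σ) (hC0 : 0 < C)
    {A ρ : ℝ} (hA : A = d * (d * Real.pi ^ 2) ^ (k + 1) * 2 ^ d) (hρ : 0 ≤ ρ)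
    (hρC : A * σ ^ 2 * ((N : ℝ) ^ d) ^ 2 * ρ ^ (2 * (k + 1) + d) ≤ C ^ 2) :
    ENNReal.ofReal (σ ^ 2 / 18 * min 1 (ρ ^ d)) ≤
      _root_.minimaxRisk {θ : (Fin d → Fin N) → ℝ | gtfPenalty N d k θ ≤ C} σ := by
  have hN' : (0 : ℝ) < N := by exact_mod_cast hN
  set q := min (N - 1) ⌊N * ρ⌋₊ with hqdef
  have hqN : q < N := lt_of_le_of_lt (min_le_left _ _) (by omega)
  have hqρ : (q : ℝ) / N ≤ ρ := by
    rw [div_le_iff₀ hN']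
    have : (q : ℝ) ≤ N * ρ :=
      le_trans (by exact_mod_cast min_le_right _ _) (Nat.floor_le (by positivity))
    linarith
  refine le_trans (ENNReal.ofReal_le_ofReal ?_)
    (minimaxRisk_ge_of_lowFrequency hd hσ hC0.le hqN ?_)
  · have hge : min 1 (ρ ^ d) ≤ (((q : ℝ) + 1) / N) ^ d := by
      rcases le_total (N - 1) ⌊N * ρ⌋₊ with h | h
      · refine (min_le_left _ _).trans (one_le_pow₀ ?_)
        rw [hqdef, min_eq_left h, Nat.cast_sub (by omega), le_div_iff₀ hN']
        simp
      · refine (min_le_right _ _).trans ?_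
        gcongr
        rw [hqdef, min_eq_right h, le_div_iff₀ hN']
        linarith [Nat.lt_floor_add_one (N * ρ)]
    calc _ ≤ σ ^ 2 / 18 * (((q : ℝ) + 1) / N) ^ d := by gcongr
      _ = _ := by push_cast; rw [div_pow]; ring
  · rcases Nat.eq_zero_or_pos q with h0 | h0
    · rw [h0]; simp; positivity
    · have hq1 : (1 : ℝ) ≤ q := by exact_mod_cast h0
      calc _ ≤ d * (N : ℝ) ^ d * ((2 * q) ^ d * (σ ^ 2 *
            (d * Real.pi ^ 2 * (q / N) ^ 2) ^ (k + 1))) := by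
            gcongr; linarith
        _ = A * σ ^ 2 * ((N : ℝ) ^ d) ^ 2 * ((q : ℝ) / N) ^ (2 * (k + 1) + d) := by
            have hqr : (q : ℝ) = N * (q / N) := by field_simp
            rw [hA]
            generalize (q : ℝ) / N = r at hqr ⊢
            rw [hqr]
            ring
        _ ≤ A * σ ^ 2 * ((N : ℝ) ^ d) ^ 2 * ρ ^ (2 * (k + 1) + d) := by
            rw [hA]; gcongr
        _ ≤ _ := hρC

/-- The smooth rate written in terms of the signal-to-noise ratio `t`. -/
lemma smooth_rate_eq (hd : 1 ≤ d) (hσ : 0 < σ) {t : ℝ} (ht : 0 < t) :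
    (t * σ) ^ ((2 : ℝ) / (2 * (((k : ℝ) + 1) / d) + 1)) *
      σ ^ ((4 * (((k : ℝ) + 1) / d)) / (2 * (((k : ℝ) + 1) / d) + 1)) =
    t ^ ((2 : ℝ) * (d / ((2 * (k + 1) + d : ℕ) : ℝ))) * σ ^ 2 := by
  have hd' : (0 : ℝ) < d := by exact_mod_cast hd
  have h1 : (2 : ℝ) / (2 * (((k : ℝ) + 1) / d) + 1) =
      2 * (d / ((2 * (k + 1) + d : ℕ) : ℝ)) := by
    push_cast; field_simp
  have h2 : (4 * (((k : ℝ) + 1) / d)) / (2 * (((k : ℝ) + 1) / d) + 1) =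
      2 - 2 * (d / ((2 * (k + 1) + d : ℕ) : ℝ)) := by
    push_cast; field_simp; ring
  rw [h1, h2, Real.mul_rpow ht.le hσ.le, mul_assoc, ← Real.rpow_add hσ, add_sub_cancel,
    Real.rpow_two]

lemma minimaxRisk_ge_smooth (hd : 1 ≤ d) (hN : 0 < N) (hσ : 0 < σ) (hC0 : 0 < C) :
    ENNReal.ofReal (min ((C / (N ^ d : ℕ)) ^ ((2 : ℝ) / (2 * (((k : ℝ) + 1) / d) + 1)) *
        σ ^ ((4 * (((k : ℝ) + 1) / d)) / (2 * (((k : ℝ) + 1) / d) + 1))) (σ ^ 2) /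
        (18 * (d * (d * Real.pi ^ 2) ^ (k + 1) * 2 ^ d))) ≤
      _root_.minimaxRisk {θ : (Fin d → Fin N) → ℝ | gtfPenalty N d k θ ≤ C} σ := by
  set A : ℝ := d * (d * Real.pi ^ 2) ^ (k + 1) * 2 ^ d with hA
  have hd' : (1 : ℝ) ≤ d := by exact_mod_cast hd
  have hpi : 1 ≤ Real.pi ^ 2 := one_le_pow₀ (by linarith [Real.pi_gt_three])
  have hA1 : 1 ≤ A :=
    one_le_mul_of_one_le_of_one_le
      (one_le_mul_of_one_le_of_one_le hd'
        (one_le_pow₀ (one_le_mul_of_one_le_of_one_le hd' hpi)))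
      (one_le_pow₀ (by norm_num))
  have hA0 : 0 < A := by linarith
  have hn : (0 : ℝ) < (N ^ d : ℕ) := by positivity
  set n : ℝ := ((N ^ d : ℕ) : ℝ) with hndef
  set t : ℝ := C / (n * σ) with htdef
  have ht : 0 < t := by positivity
  have htσ : C / n = t * σ := by rw [htdef]; field_simp
  set M := 2 * (k + 1) + d with hM
  have hM0 : (0 : ℝ) < M := by positivity
  set ρ : ℝ := (t ^ 2 / A) ^ ((M : ℝ)⁻¹) with hρdef
  have hρ0 : 0 ≤ ρ := by positivity
  have hρM : ρ ^ M = t ^ 2 / A := Real.rpow_inv_natCast_pow (by positivity) (by omega)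
  have hρd : t ^ ((2 : ℝ) * (d / (M : ℝ))) / A ≤ ρ ^ d := by
    have he : ρ ^ d = (t ^ 2) ^ ((d : ℝ) / M) / A ^ ((d : ℝ) / M) := by
      rw [hρdef, ← Real.rpow_natCast, ← Real.rpow_mul (by positivity), inv_mul_eq_div,
        Real.div_rpow (by positivity) hA0.le]
    rw [he, Real.rpow_mul ht.le, Real.rpow_two]
    gcongr
    calc A ^ ((d : ℝ) / M) ≤ A ^ (1 : ℝ) := by
          apply Real.rpow_le_rpow_of_exponent_le hA1
          rw [div_le_one hM0, hM]
          push_cast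
          linarith [(Nat.cast_nonneg k : (0 : ℝ) ≤ k)]
      _ = A := Real.rpow_one A
  refine le_trans (ENNReal.ofReal_le_ofReal ?_)
    (minimaxRisk_ge_of_bandwidth hd hN hσ hC0 hA hρ0 ?_)
  · rw [htσ, smooth_rate_eq hd hσ ht, div_le_iff₀ (by positivity)]
    calc _ = σ ^ 2 * min (t ^ ((2 : ℝ) * (d / (M : ℝ)))) 1 := by
          rw [mul_min_of_nonneg _ _ (sq_nonneg σ), mul_one, mul_comm (σ ^ 2)]
      _ ≤ σ ^ 2 * (A * min 1 (ρ ^ d)) := by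
          gcongr
          rw [mul_min_of_nonneg _ _ hA0.le, mul_one]
          refine le_min ((min_le_right _ _).trans hA1) ((min_le_left _ _).trans ?_)
          rw [div_le_iff₀ hA0] at hρd
          linarith
      _ = _ := by ring
  · rw [hρM]
    have : ((N : ℝ) ^ d) = n := by rw [hndef]; push_cast; rfl
    rw [this, htdef]
    apply le_of_eq
    field_simp

end Risk

/-- Theorem: minimax lower bound for graph trend filtering classes
on grids.  With `s = (k+1)/d`, there is `c > 0` depending only on `k, d` such that
for every `N ≥ 2` (`n = N^d ≥ 2`), `σ > 0` and `C_n > 0`, the minimax risk over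
`𝒮_{n,d}^k(C_n) = {θ : ‖S_{n,d}^{(k+1)} θ‖₁ ≤ C_n}` is at least
`c [σ²/n + min(σC_n/n, σ²) + min((C_n/n)^{2/(2s+1)} σ^{4s/(2s+1)}, σ²)]`. -/
theorem gtv_minimax_lower_bound (k d : ℕ) (hd : 1 ≤ d) :
    ∃ c : ℝ, 0 < c ∧
      ∀ N : ℕ, 2 ≤ N → 2 ≤ N ^ d →
      ∀ σ : ℝ, 0 < σ → ∀ Cn : ℝ, 0 < Cn →
        ENNReal.ofReal (c *
            (σ ^ 2 / ((N ^ d : ℕ) : ℝ) +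
              min (σ * Cn / ((N ^ d : ℕ) : ℝ)) (σ ^ 2) +
              min ((Cn / ((N ^ d : ℕ) : ℝ)) ^ ((2 : ℝ) / (2 * (((k : ℝ) + 1) / d) + 1)) *
                  σ ^ ((4 * (((k : ℝ) + 1) / d)) / (2 * (((k : ℝ) + 1) / d) + 1)))
                (σ ^ 2))) ≤
          minimaxRisk {θ : (Fin d → Fin N) → ℝ | gtfPenalty N d k θ ≤ Cn} σ := by

  set A : ℝ := d * (d * Real.pi ^ 2) ^ (k + 1) * 2 ^ d with hA
  set B : ℝ := (4 * d) ^ (k + 1) with hB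
  have hB1 : 1 ≤ B := one_le_pow_four_mul hd
  have hd0 : (0 : ℝ) < d := by exact_mod_cast hd
  have hA0 : 0 < A := by positivity
  refine ⟨1 / (3 * (18 + 36 * B + 18 * A)), by positivity, fun N hN _ σ hσ C hC => ?_⟩
  have hN0 : 0 < N := by omega
  have h1 := minimaxRisk_ge_parametric (k := k) hd hN0 hσ hC.le
  have h2 := minimaxRisk_ge_sparse (k := k) hd hN0 hσ hC
  have h3 := minimaxRisk_ge_smooth (k := k) hd hN0 hσ hC
  set R := _root_.minimaxRisk {θ : (Fin d → Fin N) → ℝ | gtfPenalty N d k θ ≤ C} σ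
  rw [← hB] at h2
  rw [← hA] at h3
  by_cases hR : R = ⊤
  · rw [hR]; exact le_top
  rw [ENNReal.ofReal_le_iff_le_toReal hR] at h1 h2 h3 ⊢
  have hR0 : 0 ≤ R.toReal := ENNReal.toReal_nonneg
  rw [div_right_comm, div_le_iff₀ (by norm_num)] at h1
  rw [div_le_iff₀ (by positivity)] at h2 h3
  rw [one_div_mul_eq_div, div_le_iff₀ (by positivity)]
  nlinarith [mul_nonneg hR0 (by linarith : (0 : ℝ) ≤ B), mul_nonneg hR0 hA0.le]
end
end

section
/- Let k ≥ 0, d ≥ 1 be integers, N > k+1, n = N^d. Let ρ_1 ≤ ⋯ ≤ ρ_N be the increasingly ordered eigenvalues of (D_N^{(k+1)})ᵀ D_N^{(k+1)}, and for i ∈ {1,…,N}^d set ξ_i = ρ_{i_1} + ⋯ + ρ_{i_d}. Define the spectral counting function F(t) = (1/n) · #{ i ∈ {1,…,N}^d : ξ_i ≤ t }. There exist constants c₁, c₂, c₃ > 0 depending only on k and d (not on N or t) such that for all t ∈ [0, max_i ξ_i]: c₁ t^{d/(2k+2)} ≤ F(t) ≤ c₂/n + c₃ t^{d/(2k+2)}.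 -/
open scoped BigOperators ENNReal NNReal
open MeasureTheory ProbabilityTheory Matrix

noncomputable section

/-- Univariate forward difference matrix `D^{(1)}_M ∈ ℝ^{(M-1)×M}`, with entries
`(D^{(1)}_M)_{i,i} = -1`, `(D^{(1)}_M)_{i,i+1} = 1` and `0` otherwise. -/
def D1 (M : ℕ) : Matrix (Fin (M - 1)) (Fin M) ℝ :=
  Matrix.of fun i j => if (j : ℕ) = (i : ℕ) then -1 else if (j : ℕ) = (i : ℕ) + 1 then 1 else 0

/-- Univariate difference operator of order `m` on `N` points:
`D^{(0)}_N = I_N` and `D^{(m+1)}_N = D^{(1)}_{N-m} D^{(m)}_N`.  In particular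
`Dop N (k+1)` is the operator `D_N^{(k+1)} ∈ ℝ^{(N-k-1) × N}`. -/
def Dop (N : ℕ) : (m : ℕ) → Matrix (Fin (N - m)) (Fin N) ℝ
  | 0 => Matrix.of fun i j => if (i : ℕ) = (j : ℕ) then 1 else 0
  | m + 1 => D1 (N - m) * Dop N m

/-- Row index type of the order-`m` KTF penalty matrix: a coordinate direction `j`,
a row index of the univariate operator, and the values of the other `d-1` lattice
coordinates. -/
abbrev KtfIdx (N d m : ℕ) :=
  Σ j : Fin d, Fin (N - m) × ({l : Fin d // l ≠ j} → Fin N)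

/-- Order-`m` KTF penalty matrix on the lattice `{1,…,N}^d`: the vertical block
concatenation over coordinate directions `j` of `I_N ⊗ ⋯ ⊗ D^{(m)}_N ⊗ ⋯ ⊗ I_N`
(`D^{(m)}_N` in the `j`-th factor). -/
def ktfMat (N d m : ℕ) : Matrix (KtfIdx N d m) (Fin d → Fin N) ℝ :=
  Matrix.of fun p x =>
    Dop N m p.2.1 (x p.1) *
      ∏ l : {l : Fin d // l ≠ p.1}, (if p.2.2 l = x l.1 then (1:ℝ) else 0)

theorem D1_mulVec (M : ℕ) (f : ℕ → ℝ) :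
    D1 M *ᵥ (fun i : Fin M => f i) = fun i : Fin (M - 1) => fwdDiff 1 f i := by
  ext i
  have h1 : (i : ℕ) + 1 < M := by omega
  have h0 : (i : ℕ) < M := by omega
  have key : ∀ j : Fin M, D1 M i j * f j =
      (if j = ⟨i, h0⟩ then -f i else 0) + (if j = ⟨i + 1, h1⟩ then f (i + 1) else 0) := by
    intro j
    simp only [D1, Matrix.of_apply, Fin.ext_iff]
    split_ifs with h h' <;> first | omega | simp_all
  simp only [Matrix.mulVec, dotProduct, key, Finset.sum_add_distrib, Finset.sum_ite_eq',
    Finset.mem_univ, if_true, fwdDiff]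
  ring

theorem Dop_mulVec (N m : ℕ) (f : ℕ → ℝ) :
    Dop N m *ᵥ (fun i : Fin N => f i) = fun i : Fin (N - m) => (fwdDiff 1)^[m] f i := by
  induction m with
  | zero =>
    have : Dop N 0 = (1 : Matrix (Fin N) (Fin N) ℝ) := by
      ext i j
      simp [Dop, Matrix.one_apply, Fin.ext_iff]
    exact (congrArg (· *ᵥ _) this).trans (Matrix.one_mulVec _)
  | succ m ih =>
    have : Dop N (m + 1) = D1 (N - m) * Dop N m := rfl
    rw [Function.iterate_succ_apply']
    exact (congrArg (· *ᵥ _) this).trans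
      ((Matrix.mulVec_mulVec _ _ _).symm.trans ((congrArg _ ih).trans (D1_mulVec (N - m) _)))

theorem Dop_mulVec_dotProduct_self (N m : ℕ) (f : ℕ → ℝ) :
    Dop N m *ᵥ (fun i : Fin N => f i) ⬝ᵥ Dop N m *ᵥ (fun i : Fin N => f i) =
      ∑ i ∈ Finset.range (N - m), ((fwdDiff 1)^[m] f i) ^ 2 := by
  rw [Dop_mulVec, Finset.sum_range]
  simp [dotProduct, sq]

theorem exists_nat_extension {N : ℕ} (v : Fin N → ℝ) : ∃ f : ℕ → ℝ, v = fun i : Fin N => f i :=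
  ⟨fun i => if h : i < N then v ⟨i, h⟩ else 0, by ext i; simp⟩

theorem sum_sq_fwdDiff_le (f : ℕ → ℝ) (n : ℕ) :
    ∑ i ∈ Finset.range (n - 1), (fwdDiff 1 f i) ^ 2 ≤ 4 * ∑ i ∈ Finset.range n, f i ^ 2 := by
  have h1 : ∑ i ∈ Finset.range (n - 1), f i ^ 2 ≤ ∑ i ∈ Finset.range n, f i ^ 2 :=
    Finset.sum_le_sum_of_subset_of_nonneg (Finset.range_mono (by omega)) fun _ _ _ => sq_nonneg _
  have h2 : ∑ i ∈ Finset.range (n - 1), f (i + 1) ^ 2 ≤ ∑ i ∈ Finset.range n, f i ^ 2 := by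
    rcases n with _ | n
    · simp
    · rw [Finset.sum_range_succ' _ n]
      simpa using sq_nonneg (f 0)
  calc ∑ i ∈ Finset.range (n - 1), (fwdDiff 1 f i) ^ 2
      ≤ ∑ i ∈ Finset.range (n - 1), (2 * f (i + 1) ^ 2 + 2 * f i ^ 2) := by
        refine Finset.sum_le_sum fun i _ => ?_
        simp only [fwdDiff]
        nlinarith [sq_nonneg (f (i + 1) + f i)]
    _ ≤ _ := by
        rw [Finset.sum_add_distrib, ← Finset.mul_sum, ← Finset.mul_sum]
        linarith

theorem sum_sq_fwdDiff_iterate_le (f : ℕ → ℝ) (n m : ℕ) :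
    ∑ i ∈ Finset.range (n - m), ((fwdDiff 1)^[m] f i) ^ 2 ≤
      4 ^ m * ∑ i ∈ Finset.range n, f i ^ 2 := by
  induction m with
  | zero => simp
  | succ m ih =>
    rw [Function.iterate_succ_apply', pow_succ', mul_assoc]
    exact (sum_sq_fwdDiff_le _ (n - m)).trans (by gcongr)

theorem sq_le_of_eq_zero_of_mod_eq_zero {f : ℕ → ℝ} {b n : ℕ}
    (hf : ∀ i < n, i % b = 0 → f i = 0) {i : ℕ} (hb : 0 < b) (hi : i < n) :
    f i ^ 2 ≤ b * ∑ j ∈ (Finset.range (n - 1)).filter (fun j => j / b = i / b),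
      (fwdDiff 1 f j) ^ 2 := by
  have hmod : b * (i / b) + i % b = i := Nat.div_add_mod i b
  have hlt : i % b < b := Nat.mod_lt _ hb
  have h0 : f (b * (i / b)) = 0 := hf _ (by omega) (by simp)
  have htel : ∑ j ∈ Finset.range (i % b), fwdDiff 1 f (b * (i / b) + j) = f i := by
    have := Finset.sum_range_sub (fun j => f (b * (i / b) + j)) (i % b)
    simp only [hmod, add_zero, h0, sub_zero] at this
    rw [← this]
    rfl
  have hcs := sq_sum_le_card_mul_sum_sq (s := Finset.range (i % b))
    (f := fun j => fwdDiff 1 f (b * (i / b) + j))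
  rw [htel, Finset.card_range] at hcs
  have hsub : ∑ j ∈ Finset.range (i % b), (fwdDiff 1 f (b * (i / b) + j)) ^ 2 ≤
      ∑ j ∈ (Finset.range (n - 1)).filter (fun j => j / b = i / b), (fwdDiff 1 f j) ^ 2 := by
    rw [← Finset.sum_image (f := fun j => (fwdDiff 1 f j) ^ 2)
      (g := fun j => b * (i / b) + j) (by intro x _ y _; simp)]
    refine Finset.sum_le_sum_of_subset_of_nonneg ?_ fun _ _ _ => sq_nonneg _
    intro j hj
    simp only [Finset.mem_image, Finset.mem_range, Finset.mem_filter] at hj ⊢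
    obtain ⟨a, ha, rfl⟩ := hj
    refine ⟨by omega, ?_⟩
    rw [Nat.mul_add_div hb, Nat.div_eq_of_lt (ha.trans hlt), add_zero]
  calc f i ^ 2 ≤ _ := hcs
    _ ≤ _ := by
      gcongr

theorem sum_sq_le_sum_sq_fwdDiff {f : ℕ → ℝ} {b n : ℕ} (hb : 0 < b)
    (hf : ∀ i < n, i % b = 0 → f i = 0) :
    ∑ i ∈ Finset.range n, f i ^ 2 ≤
      (b : ℝ) ^ 2 * ∑ i ∈ Finset.range (n - 1), (fwdDiff 1 f i) ^ 2 := by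
  calc ∑ i ∈ Finset.range n, f i ^ 2
      ≤ ∑ i ∈ Finset.range n, b * ∑ j ∈ (Finset.range (n - 1)).filter (fun j => j / b = i / b),
          (fwdDiff 1 f j) ^ 2 := Finset.sum_le_sum fun i hi =>
        sq_le_of_eq_zero_of_mod_eq_zero hf hb (Finset.mem_range.1 hi)
    _ = b * ∑ j ∈ Finset.range (n - 1), ∑ i ∈ Finset.range n,
          if j / b = i / b then (fwdDiff 1 f j) ^ 2 else 0 := by
        rw [← Finset.mul_sum, Finset.sum_comm]
        simp only [Finset.sum_filter]
    _ ≤ b * ∑ j ∈ Finset.range (n - 1), b * (fwdDiff 1 f j) ^ 2 := by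
        gcongr with j hj
        rw [← Finset.sum_filter, Finset.sum_const, nsmul_eq_mul]
        gcongr
        calc _ ≤ (Finset.Ico (b * (j / b)) (b * (j / b) + b)).card := by
              refine Finset.card_le_card fun i hi => ?_
              simp only [Finset.mem_filter, Finset.mem_Ico] at hi ⊢
              rw [hi.2]
              have := Nat.div_add_mod i b
              have := Nat.mod_lt i hb
              omega
          _ = b := by simp
    _ = _ := by rw [← Finset.mul_sum]; ring

theorem sum_sq_le_sum_sq_fwdDiff_iterate {b : ℕ} (hb : 0 < b) (m : ℕ) :
    ∀ {f : ℕ → ℝ} {n : ℕ}, (∀ i < n, i % b < m → f i = 0) →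
    ∑ i ∈ Finset.range n, f i ^ 2 ≤
      (b : ℝ) ^ (2 * m) * ∑ i ∈ Finset.range (n - m), ((fwdDiff 1)^[m] f i) ^ 2 := by
  induction m with
  | zero => intro f n _; simp
  | succ m ih =>
    intro f n hf
    have hstep := sum_sq_le_sum_sq_fwdDiff hb fun i hi h => hf i hi (by omega)
    have hdiff : ∀ i < n - 1, i % b < m → fwdDiff 1 f i = 0 := by
      intro i hi him
      have h1 : (i + 1) % b < m + 1 := by
        rw [Nat.add_mod]
        exact (Nat.mod_le _ _).trans_lt
          (lt_of_le_of_lt (Nat.add_le_add_left (Nat.mod_le 1 b) _) (by omega))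
      simp [fwdDiff, hf i (by omega) (by omega), hf (i + 1) (by omega) h1]
    have := ih hdiff
    rw [Function.iterate_succ_apply, show n - (m + 1) = n - 1 - m by omega,
      show (b : ℝ) ^ (2 * (m + 1)) = b ^ 2 * b ^ (2 * m) by ring, mul_assoc]
    exact hstep.trans (by gcongr)

section Spectral

variable {ι : Type*} [Fintype ι] [DecidableEq ι]

theorem Matrix.IsHermitian.exists_orthogonal_diagonalization {A : Matrix ι ι ℝ}
    (hA : A.IsHermitian) :
    ∃ U : Matrix ι ι ℝ, Uᵀ * U = 1 ∧ U * Uᵀ = 1 ∧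
      Uᵀ * A * U = Matrix.diagonal hA.eigenvalues := by
  have hstar : star (hA.eigenvectorUnitary : Matrix ι ι ℝ) =
      (hA.eigenvectorUnitary : Matrix ι ι ℝ)ᵀ := by
    rw [Matrix.star_eq_conjTranspose, Matrix.conjTranspose_eq_transpose_of_trivial]
  have h1 := Unitary.coe_star_mul_self hA.eigenvectorUnitary
  have h2 : (hA.eigenvectorUnitary : Matrix ι ι ℝ) *
      star (hA.eigenvectorUnitary : Matrix ι ι ℝ) = 1 :=
    Unitary.coe_mul_star_self hA.eigenvectorUnitary
  rw [hstar] at h1 h2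
  refine ⟨hA.eigenvectorUnitary, h1, h2, ?_⟩
  have h := hA.conjStarAlgAut_star_eigenvectorUnitary
  rw [Unitary.conjStarAlgAut_apply] at h
  rw [← hstar]
  simpa using h

theorem Matrix.IsHermitian.exists_diagonalizing_coordinates {κ : Type*} [Fintype κ]
    {B : Matrix κ ι ℝ} (hA : (Bᵀ * B).IsHermitian) :
    ∃ e : (ι → ℝ) ≃ₗ[ℝ] (ι → ℝ), ∀ y : ι → ℝ,
      e y ⬝ᵥ e y = ∑ i, y i ^ 2 ∧
      B *ᵥ e y ⬝ᵥ B *ᵥ e y = ∑ i, hA.eigenvalues i * y i ^ 2 := by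
  obtain ⟨U, h1, h2, h3⟩ := hA.exists_orthogonal_diagonalization
  refine ⟨LinearEquiv.ofLinearMap (Matrix.toLin' U) (Matrix.toLin' Uᵀ)
    (by rw [← Matrix.toLin'_mul, h2, Matrix.toLin'_one])
    (by rw [← Matrix.toLin'_mul, h1, Matrix.toLin'_one]), fun y => ⟨?_, ?_⟩⟩
  · have : U *ᵥ y ⬝ᵥ U *ᵥ y = y ⬝ᵥ ((Uᵀ * U) *ᵥ y) := by
      rw [← Matrix.mulVec_mulVec, Matrix.dotProduct_mulVec y, Matrix.vecMul_transpose]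
    simp only [LinearEquiv.coe_ofLinearMap, Matrix.toLin'_apply]
    rw [this, h1, Matrix.one_mulVec]
    simp [dotProduct, sq]
  · have : B *ᵥ U *ᵥ y ⬝ᵥ B *ᵥ U *ᵥ y = y ⬝ᵥ ((Uᵀ * (Bᵀ * B) * U) *ᵥ y) := by
      rw [← Matrix.mulVec_mulVec, ← Matrix.mulVec_mulVec, ← Matrix.mulVec_mulVec,
        Matrix.dotProduct_mulVec y, Matrix.vecMul_transpose,
        Matrix.dotProduct_mulVec _ Bᵀ, Matrix.vecMul_transpose]
    simp only [LinearEquiv.coe_ofLinearMap, Matrix.toLin'_apply]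
    rw [this, h3]
    simp only [dotProduct, Matrix.mulVec_diagonal]
    exact Finset.sum_congr rfl fun i _ => by ring

theorem le_card_eigenvalues_le {κ η : Type*} [Fintype κ] [Fintype η]
    {B : Matrix κ ι ℝ} (hA : (Bᵀ * B).IsHermitian) (s : ℝ)
    (L : (η → ℝ) →ₗ[ℝ] (ι → ℝ)) (hL : Function.Injective L)
    (h : ∀ c, B *ᵥ L c ⬝ᵥ B *ᵥ L c ≤ s * (L c ⬝ᵥ L c)) :
    Fintype.card η ≤ (Finset.univ.filter fun i => hA.eigenvalues i ≤ s).card := by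
  obtain ⟨e, he⟩ := hA.exists_diagonalizing_coordinates
  let R : (ι → ℝ) →ₗ[ℝ] ({i // hA.eigenvalues i ≤ s} → ℝ) := LinearMap.funLeft ℝ ℝ Subtype.val
  have hinj : Function.Injective (R ∘ₗ e.symm.toLinearMap ∘ₗ L) := by
    rw [← LinearMap.ker_eq_bot, LinearMap.ker_eq_bot']
    intro c hc
    have hc0 : ∀ i, hA.eigenvalues i ≤ s → e.symm (L c) i = 0 := fun i hi => congrFun hc ⟨i, hi⟩
    obtain ⟨y, hy⟩ : ∃ y, L c = e y := ⟨e.symm (L c), by simp⟩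
    have hq := h c
    simp only [hy, LinearEquiv.symm_apply_apply, (he y).1, (he y).2] at hc0 hq
    have hnn : ∀ i ∈ Finset.univ, 0 ≤ (hA.eigenvalues i - s) * y i ^ 2 := by
      intro i _
      rcases le_or_gt (hA.eigenvalues i) s with hi | hi
      · simp [hc0 i hi]
      · exact mul_nonneg (by linarith) (sq_nonneg _)
    have hz : ∑ i, (hA.eigenvalues i - s) * y i ^ 2 = 0 := by
      refine le_antisymm ?_ (Finset.sum_nonneg hnn)
      simp only [sub_mul, Finset.sum_sub_distrib, ← Finset.mul_sum]
      linarith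
    have hy0 : y = 0 := by
      ext i
      rcases le_or_gt (hA.eigenvalues i) s with hi | hi
      · exact hc0 i hi
      · have := (Finset.sum_eq_zero_iff_of_nonneg hnn).1 hz i (Finset.mem_univ i)
        rcases mul_eq_zero.1 this with h' | h'
        · linarith
        · simpa using h'
    exact hL (by rw [hy, hy0, map_zero, map_zero])
  have := LinearMap.finrank_le_finrank_of_injective hinj
  rwa [Module.finrank_fintype_fun_eq_card, Module.finrank_fintype_fun_eq_card,
    Fintype.card_subtype] at this

theorem card_eigenvalues_le_le {κ : Type*} [Fintype κ]
    {B : Matrix κ ι ℝ} (hA : (Bᵀ * B).IsHermitian) (s : ℝ) (S : Finset ι)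
    (h : ∀ v : ι → ℝ, (∀ i ∈ S, v i = 0) → v ≠ 0 → s * (v ⬝ᵥ v) < B *ᵥ v ⬝ᵥ B *ᵥ v) :
    (Finset.univ.filter fun i => hA.eigenvalues i ≤ s).card ≤ S.card := by
  obtain ⟨e, he⟩ := hA.exists_diagonalizing_coordinates
  let R : (ι → ℝ) →ₗ[ℝ] (S → ℝ) := LinearMap.funLeft ℝ ℝ Subtype.val
  let E := Function.ExtendByZero.linearMap ℝ
    (Subtype.val : {i // hA.eigenvalues i ≤ s} → ι)
  have hinj : Function.Injective (R ∘ₗ e.toLinearMap ∘ₗ E) := by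
    rw [← LinearMap.ker_eq_bot, LinearMap.ker_eq_bot']
    intro c hc
    have hv : ∀ i ∈ S, e (E c) i = 0 := fun i hi => congrFun hc ⟨i, hi⟩
    have hE : ∀ i : {i // hA.eigenvalues i ≤ s}, E c i = c i := fun i =>
      Subtype.val_injective.extend_apply c 0 i
    have hE0 : ∀ i, ¬ hA.eigenvalues i ≤ s → E c i = 0 := fun i hi =>
      by
      refine Function.extend_apply' c (0 : ι → ℝ) i ?_
      rintro ⟨a, rfl⟩
      exact hi a.2
    have hzero : e (E c) = 0 := by
      by_contra hne
      refine (h _ hv hne).not_ge ?_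
      rw [(he _).1, (he _).2, Finset.mul_sum]
      refine Finset.sum_le_sum fun i _ => ?_
      by_cases hi : hA.eigenvalues i ≤ s
      · gcongr
      · simp [hE0 i hi]
    have hEc : E c = 0 := by simpa using hzero
    ext i
    rw [← hE i, hEc]
    rfl
  have := LinearMap.finrank_le_finrank_of_injective hinj
  rwa [Module.finrank_fintype_fun_eq_card, Module.finrank_fintype_fun_eq_card,
    Fintype.card_subtype, Fintype.card_coe] at this

end Spectral

section Bump

open Polynomial

theorem coeff_mul_sum_C_mul_X_pow {p : ℝ[X]} {M : ℕ} (hp : p.natDegree < M) (c : ℕ → ℝ)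
    (R i : ℕ) :
    (p * ∑ r ∈ Finset.range R, C (c r) * X ^ (r * M)).coeff i =
      if i / M < R then c (i / M) * p.coeff (i % M) else 0 := by
  have hM : 0 < M := by omega
  have key : ∀ r, (p * (C (c r) * X ^ (r * M))).coeff i =
      if r = i / M then c (i / M) * p.coeff (i % M) else 0 := by
    intro r
    rw [← mul_assoc, mul_comm p, coeff_mul_X_pow', coeff_C_mul]
    have hdm := Nat.div_add_mod i M
    have hlt := Nat.mod_lt i hM
    by_cases hr : r = i / M
    · subst hr
      rw [if_pos (Nat.div_mul_le_self i M), if_pos rfl, Nat.mul_comm (i / M) M]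
      congr 2
      omega
    · rw [if_neg hr]
      split_ifs with hle
      · have h1 : r < i / M := lt_of_le_of_ne ((Nat.le_div_iff_mul_le hM).2 hle) hr
        have h2 : (r + 1) * M ≤ i := (Nat.le_div_iff_mul_le hM).1 h1
        rw [coeff_eq_zero_of_natDegree_lt, mul_zero]
        rw [Nat.add_mul] at h2
        omega
      · rfl
  rw [Finset.mul_sum, finsetSum_coeff]
  simp only [key, Finset.sum_ite_eq', Finset.mem_range]

theorem sum_sq_mul_div_mod (c g : ℕ → ℝ) (M R : ℕ) :
    ∑ i ∈ Finset.range (R * M), (c (i / M) * g (i % M)) ^ 2 =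
      (∑ r ∈ Finset.range R, c r ^ 2) * ∑ j ∈ Finset.range M, g j ^ 2 := by
  induction R with
  | zero => simp
  | succ R ih =>
    rw [Nat.succ_mul, Finset.sum_range_add, ih, Finset.sum_range_succ, add_mul,
      Finset.mul_sum _ _ (c R ^ 2)]
    congr 1
    refine Finset.sum_congr rfl fun j hj => ?_
    have hj := Finset.mem_range.1 hj
    rw [Nat.mul_comm R M, Nat.mul_add_div (by omega), Nat.div_eq_of_lt hj, Nat.mul_add_mod,
      Nat.mod_eq_of_lt hj, add_zero, mul_pow]

theorem sum_sq_coeff_mul_sum_C_mul_X_pow {p : ℝ[X]} {M : ℕ} (hp : p.natDegree < M) (c : ℕ → ℝ)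
    {R n : ℕ} (hn : R * M ≤ n) :
    ∑ i ∈ Finset.range n, ((p * ∑ r ∈ Finset.range R, C (c r) * X ^ (r * M)).coeff i) ^ 2 =
      (∑ r ∈ Finset.range R, c r ^ 2) * ∑ j ∈ Finset.range M, p.coeff j ^ 2 := by
  have hM : 0 < M := by omega
  rw [← sum_sq_mul_div_mod, ← Finset.sum_subset (Finset.range_mono hn)]
  · refine Finset.sum_congr rfl fun i hi => ?_
    rw [coeff_mul_sum_C_mul_X_pow hp,
      if_pos ((Nat.div_lt_iff_lt_mul hM).2 (Finset.mem_range.1 hi))]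
  · intro i _ hi
    rw [coeff_mul_sum_C_mul_X_pow hp, if_neg, sq, mul_zero]
    rwa [Nat.div_lt_iff_lt_mul hM, ← Finset.mem_range]

theorem fwdDiff_iterate_coeff (p : ℝ[X]) (m i : ℕ) :
    (fwdDiff 1)^[m] p.coeff i = ((1 - X) ^ m * p).coeff (i + m) := by
  induction m generalizing i with
  | zero => simp
  | succ m ih =>
    rw [Function.iterate_succ_apply', pow_succ', mul_assoc, sub_mul, one_mul, ← add_assoc,
      coeff_sub, coeff_X_mul, fwdDiff, ih, ih, Nat.add_right_comm]

theorem sum_sq_fwdDiff_iterate_coeff_le (p : ℝ[X]) {m n : ℕ} (hm : m ≤ n) :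
    ∑ i ∈ Finset.range (n - m), ((fwdDiff 1)^[m] p.coeff i) ^ 2 ≤
      ∑ i ∈ Finset.range n, (((1 - X) ^ m * p).coeff i) ^ 2 := by
  simp only [fwdDiff_iterate_coeff]
  obtain ⟨a, rfl⟩ := Nat.exists_eq_add_of_le hm
  rw [Finset.sum_range_add, Nat.add_sub_cancel_left]
  simp only [Nat.add_comm m]
  exact le_add_of_nonneg_left (Finset.sum_nonneg fun _ _ => sq_nonneg _)

theorem abs_coeff_one_sub_X_pow_mul_geom_le (l m j : ℕ) :
    |((1 - X ^ l) ^ m * ∑ i ∈ Finset.range l, (X : ℝ[X]) ^ i).coeff j| ≤ 2 ^ m := by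
  induction m generalizing j with
  | zero =>
    rw [pow_zero, one_mul, finsetSum_coeff, pow_zero]
    simp only [coeff_X_pow, Finset.sum_ite_eq]
    split_ifs <;> simp
  | succ m ih =>
    rw [pow_succ', mul_assoc, sub_mul, one_mul, coeff_sub, coeff_X_pow_mul']
    refine (abs_sub _ _).trans ?_
    have h2 : |if l ≤ j then ((1 - X ^ l) ^ m * ∑ i ∈ Finset.range l, (X : ℝ[X]) ^ i).coeff (j - l)
        else 0| ≤ 2 ^ m := by
      split_ifs
      · exact ih _
      · simp
    rw [pow_succ']
    linarith [ih j]

theorem natDegree_geom_le (l : ℕ) :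
    (∑ i ∈ Finset.range l, (X : ℝ[X]) ^ i).natDegree ≤ l - 1 := by
  refine natDegree_sum_le_of_forall_le _ _ fun i hi => ?_
  rw [natDegree_X_pow]
  have := Finset.mem_range.1 hi
  omega

/-- A discrete B-spline of order `m + 1` and width `l`, together with the bound on its `m`-th
difference. -/
theorem exists_bump (m : ℕ) {l : ℕ} (hl : 0 < l) :
    ∃ p : ℝ[X], p.natDegree < (m + 1) * l ∧ ((1 - X) ^ m * p).natDegree < (m + 1) * l ∧
      0 < ∑ j ∈ Finset.range ((m + 1) * l), p.coeff j ^ 2 ∧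
      (∑ j ∈ Finset.range ((m + 1) * l), (((1 - X) ^ m * p).coeff j) ^ 2) * (l : ℝ) ^ (2 * m) ≤
        4 ^ m * (m + 1) ^ 2 * ∑ j ∈ Finset.range ((m + 1) * l), p.coeff j ^ 2 := by
  set S : ℝ[X] := ∑ i ∈ Finset.range l, X ^ i with hS
  have hSdeg : S.natDegree ≤ l - 1 := natDegree_geom_le l
  have hG : (1 - X) ^ m * S ^ (m + 1) = (1 - X ^ l) ^ m * S := by
    rw [pow_succ, ← mul_assoc, ← mul_pow, hS, mul_neg_geom_sum]
  have hpdeg : (S ^ (m + 1)).natDegree < (m + 1) * l := by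
    refine (natDegree_pow_le.trans (Nat.mul_le_mul_left _ hSdeg)).trans_lt ?_
    exact Nat.mul_lt_mul_of_pos_left (by omega) (by omega)
  have hsum : ∑ j ∈ Finset.range ((m + 1) * l), (S ^ (m + 1)).coeff j = (l : ℝ) ^ (m + 1) := by
    have := eval_eq_sum_range' hpdeg (1 : ℝ)
    simp only [one_pow, mul_one] at this
    rw [← this]
    simp [hS, eval_pow, eval_finsetSum]
  have hcs := sq_sum_le_card_mul_sum_sq (s := Finset.range ((m + 1) * l))
    (f := fun j => (S ^ (m + 1)).coeff j)
  rw [hsum, Finset.card_range] at hcs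
  push_cast at hcs
  have hl' : (0 : ℝ) < l := by exact_mod_cast hl
  set Q := ∑ j ∈ Finset.range ((m + 1) * l), (S ^ (m + 1)).coeff j ^ 2
  have hQ : (l : ℝ) ^ (2 * m + 1) ≤ (m + 1) * Q := by
    refine le_of_mul_le_mul_left ?_ hl'
    calc (l : ℝ) * l ^ (2 * m + 1) = (l ^ (m + 1)) ^ 2 := by ring
      _ ≤ _ := hcs
      _ = _ := by ring
  refine ⟨S ^ (m + 1), hpdeg, ?_, ?_, ?_⟩
  · rw [hG]
    have h1 : ((1 : ℝ[X]) - X ^ l).natDegree ≤ l :=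
      (natDegree_sub_le _ _).trans (by simp)
    have h2 := natDegree_mul_le (p := ((1 : ℝ[X]) - X ^ l) ^ m) (q := S)
    have h3 := (natDegree_pow_le (p := (1 : ℝ[X]) - X ^ l) (n := m)).trans
      (Nat.mul_le_mul_left m h1)
    rw [Nat.add_mul]
    omega
  · have : (0 : ℝ) < l ^ (2 * m + 1) := by positivity
    exact pos_of_mul_pos_right (this.trans_le hQ) (by positivity)
  · have hGs : ∑ j ∈ Finset.range ((m + 1) * l), (((1 - X) ^ m * S ^ (m + 1)).coeff j) ^ 2 ≤
        ((m + 1 : ℝ) * l) * 4 ^ m := by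
      rw [hG]
      refine (Finset.sum_le_card_nsmul _ _ ((4 : ℝ) ^ m) fun j _ => ?_).trans (by simp)
      rw [← sq_abs, show (4 : ℝ) ^ m = (2 ^ m) ^ 2 by rw [← pow_mul, mul_comm, pow_mul]; norm_num]
      gcongr
      exact abs_coeff_one_sub_X_pow_mul_geom_le l m j
    calc _ ≤ ((m + 1 : ℝ) * l) * 4 ^ m * (l : ℝ) ^ (2 * m) := by gcongr
      _ = (m + 1) * 4 ^ m * (l : ℝ) ^ (2 * m + 1) := by ring
      _ ≤ (m + 1) * 4 ^ m * ((m + 1) * Q) := by gcongr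
      _ = _ := by ring

end Bump

theorem card_filter_mod_lt_le (N m b : ℕ) :
    (Finset.univ.filter fun i : Fin N => (i : ℕ) % b < m).card ≤ m * (N / b + 1) := by
  calc _ ≤ (Finset.range m ×ˢ Finset.range (N / b + 1)).card := by
        refine Finset.card_le_card_of_injOn (fun i => ((i : ℕ) % b, (i : ℕ) / b)) ?_ ?_
        · intro i hi
          have hi : (i : ℕ) % b < m := by simpa using hi
          simpa [hi, Nat.lt_succ_iff] using Nat.div_le_div_right i.2.le
        · intro i _ j _ hij
          simp only [Prod.mk.injEq] at hij
          ext
          rw [← Nat.div_add_mod i b, ← Nat.div_add_mod j b, hij.1, hij.2]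
    _ = _ := by simp

theorem dotProduct_self_eq_sum_range {N : ℕ} (f : ℕ → ℝ) :
    (fun i : Fin N => f i) ⬝ᵥ (fun i : Fin N => f i) = ∑ i ∈ Finset.range N, f i ^ 2 := by
  rw [Finset.sum_range]
  simp [dotProduct, sq]

theorem card_eigenvalues_Dop_le_of_mul_lt_one {N m b : ℕ}
    (hH : ((Dop N m)ᵀ * Dop N m).IsHermitian) (hb : 0 < b) {s : ℝ}
    (hs : s * (b : ℝ) ^ (2 * m) < 1) :
    (Finset.univ.filter fun i => hH.eigenvalues i ≤ s).card ≤ m * (N / b + 1) := by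
  refine (card_eigenvalues_le_le hH s _ ?_).trans (card_filter_mod_lt_le N m b)
  intro v hv hne
  have hpos : 0 < v ⬝ᵥ v :=
    lt_of_le_of_ne (Finset.sum_nonneg fun i _ => mul_self_nonneg _)
      (Ne.symm (dotProduct_self_eq_zero.not.2 hne))
  obtain ⟨f, rfl⟩ := exists_nat_extension v
  rw [Dop_mulVec_dotProduct_self]
  rw [dotProduct_self_eq_sum_range] at hpos ⊢
  have h := sum_sq_le_sum_sq_fwdDiff_iterate hb m (f := f) (n := N) fun i hi him =>
    hv ⟨i, hi⟩ (by simpa using him)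
  set E := ∑ i ∈ Finset.range (N - m), ((fwdDiff 1)^[m] f i) ^ 2
  have hbp : (0 : ℝ) < (b : ℝ) ^ (2 * m) := by positivity
  have hE : 0 < E := pos_of_mul_pos_right (hpos.trans_le h) hbp.le
  rcases le_or_gt s 0 with h0 | h0
  · exact (mul_nonpos_of_nonpos_of_nonneg h0 hpos.le).trans_lt hE
  · calc _ ≤ s * ((b : ℝ) ^ (2 * m) * E) := by gcongr
      _ = s * (b : ℝ) ^ (2 * m) * E := by ring
      _ < 1 * E := by gcongr
      _ = E := one_mul E

theorem card_eigenvalues_Dop_le {N m : ℕ} (hm : 0 < m)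
    (hH : ((Dop N m)ᵀ * Dop N m).IsHermitian) {u : ℝ} (hu : 0 ≤ u) :
    ((Finset.univ.filter fun i => hH.eigenvalues i ≤ u ^ (2 * m)).card : ℝ) ≤
      m + 2 * m * N * u := by
  have hm1 : (1 : ℝ) ≤ m := by exact_mod_cast hm
  rcases le_or_gt 1 u with h1 | h1
  · have hc : ((Finset.univ.filter fun i => hH.eigenvalues i ≤ u ^ (2 * m)).card : ℝ) ≤ N := by
      exact_mod_cast (Finset.card_le_univ _).trans_eq (Fintype.card_fin N)
    have : (1 : ℝ) ≤ 2 * m * u := by nlinarith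
    nlinarith [(Nat.cast_nonneg N : (0 : ℝ) ≤ N)]
  obtain ⟨b, hb, hbu, hNb⟩ : ∃ b : ℕ, 0 < b ∧ b * u < 1 ∧ ((N / b : ℕ) : ℝ) ≤ 2 * N * u := by
    rcases hu.eq_or_lt with rfl | hpos
    · exact ⟨N + 1, by omega, by simp, by simp⟩
    · have hceil : 1 < ⌈1 / u⌉₊ := Nat.lt_ceil.2 (by rw [lt_div_iff₀ hpos]; simpa using h1)
      obtain ⟨b, hb⟩ := Nat.exists_eq_add_of_le' hceil.le
      have hb1 : (1 : ℝ) ≤ b := by exact_mod_cast (by omega : 1 ≤ b)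
      have hlt : (b : ℝ) < 1 / u := Nat.lt_ceil.1 (by omega)
      have hle : 1 / u ≤ b + 1 := by
        have := Nat.le_ceil (1 / u)
        rw [hb] at this
        exact_mod_cast this
      refine ⟨b, by omega, (lt_div_iff₀ hpos).1 hlt, Nat.cast_div_le.trans ?_⟩
      rw [div_le_iff₀ hpos] at hle
      rw [div_le_iff₀ (by linarith)]
      have : (1 : ℝ) ≤ 2 * u * b := by nlinarith
      nlinarith [(Nat.cast_nonneg N : (0 : ℝ) ≤ N)]
  have h := card_eigenvalues_Dop_le_of_mul_lt_one hH hb (s := u ^ (2 * m)) (by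
    rw [← mul_pow, mul_comm]
    exact pow_lt_one₀ (by positivity) hbu (by omega))
  calc _ ≤ ((m * (N / b + 1) : ℕ) : ℝ) := by exact_mod_cast h
    _ = m * ((N / b : ℕ) + 1) := by push_cast; ring
    _ ≤ m * (2 * N * u + 1) := by gcongr
    _ = _ := by ring

theorem one_le_card_eigenvalues_Dop {N m : ℕ} (hm : 0 < m) (hN : m < N)
    (hH : ((Dop N m)ᵀ * Dop N m).IsHermitian) {s : ℝ} (hs : 0 ≤ s) :
    1 ≤ (Finset.univ.filter fun i => hH.eigenvalues i ≤ s).card := by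
  let L : (Fin 1 → ℝ) →ₗ[ℝ] (Fin N → ℝ) :=
    LinearMap.toSpanSingleton ℝ (Fin N → ℝ) 1 ∘ₗ LinearMap.proj 0
  have hinj : Function.Injective L := by
    intro c c' h
    ext i
    have := congrFun h ⟨0, by omega⟩
    rw [Subsingleton.elim i 0]
    simpa [L] using this
  have := le_card_eigenvalues_le (η := Fin 1) hH s _ hinj fun c => by
    have h1 : L c = fun i : Fin N => (fun _ : ℕ => c 0) i := by
      ext i; simp [L]
    rw [h1]
    refine (Dop_mulVec_dotProduct_self N m fun _ => c 0).trans_le ?_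
    obtain ⟨m, rfl⟩ := Nat.exists_eq_add_of_le' hm
    have h2 : (fwdDiff 1)^[m + 1] (fun _ : ℕ => c 0) = fun _ => 0 := by
      rw [Function.iterate_succ_apply, fwdDiff_const]
      clear * -
      induction m with
      | zero => rfl
      | succ m ih => rw [Function.iterate_succ_apply, fwdDiff_const, ih]
    rw [h2]
    simp only [ne_eq, OfNat.ofNat_ne_zero, not_false_eq_true, zero_pow, Finset.sum_const_zero]
    exact mul_nonneg hs (Finset.sum_nonneg fun i _ => mul_self_nonneg _)
  simpa using this

open Polynomial in
theorem le_card_eigenvalues_Dop_of_le {N m l R : ℕ} (hN : m ≤ N)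
    (hH : ((Dop N m)ᵀ * Dop N m).IsHermitian) (hl : 0 < l) (hR : R * ((m + 1) * l) ≤ N) {s : ℝ}
    (hs : 4 ^ m * (m + 1) ^ 2 ≤ s * (l : ℝ) ^ (2 * m)) :
    R ≤ (Finset.univ.filter fun i => hH.eigenvalues i ≤ s).card := by
  obtain ⟨p, hp, hq, hpos, hle⟩ := exists_bump m hl
  let P : (Fin R → ℝ) →ₗ[ℝ] ℝ[X] :=
    LinearMap.mulLeft ℝ p ∘ₗ ∑ r : Fin R, monomial ((r : ℕ) * ((m + 1) * l)) ∘ₗ LinearMap.proj r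
  let L : (Fin R → ℝ) →ₗ[ℝ] (Fin N → ℝ) := LinearMap.pi fun i => lcoeff ℝ i ∘ₗ P
  have hP : ∀ c : ℕ → ℝ, P (fun r => c r) =
      p * ∑ r ∈ Finset.range R, C (c r) * X ^ (r * ((m + 1) * l)) := by
    intro c
    simp [P, Finset.sum_range, C_mul_X_pow_eq_monomial, Finset.mul_sum]
  have hL : ∀ c, L c = fun i : Fin N => (P c).coeff i := fun c => rfl
  have hLsq : ∀ c : ℕ → ℝ, L (fun r => c r) ⬝ᵥ L (fun r => c r) =
      (∑ r ∈ Finset.range R, c r ^ 2) * ∑ j ∈ Finset.range ((m + 1) * l), p.coeff j ^ 2 := by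
    intro c
    rw [hL, dotProduct_self_eq_sum_range, hP, sum_sq_coeff_mul_sum_C_mul_X_pow hp c hR]
  have hinj : Function.Injective L := by
    rw [← LinearMap.ker_eq_bot, LinearMap.ker_eq_bot']
    intro c hc
    obtain ⟨c, rfl⟩ := exists_nat_extension c
    have h := hLsq c
    rw [hc, dotProduct_zero, eq_comm, mul_eq_zero, or_iff_left hpos.ne',
      Finset.sum_eq_zero_iff_of_nonneg fun _ _ => sq_nonneg _] at h
    ext r
    simpa using h r (Finset.mem_range.2 r.2)
  have := le_card_eigenvalues_le hH s L hinj fun c => by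
    obtain ⟨c, rfl⟩ := exists_nat_extension c
    rw [hLsq, hL, Dop_mulVec_dotProduct_self]
    refine (sum_sq_fwdDiff_iterate_coeff_le _ hN).trans ?_
    rw [hP, ← mul_assoc, sum_sq_coeff_mul_sum_C_mul_X_pow hq c hR, mul_left_comm]
    refine mul_le_mul_of_nonneg_left ?_ (Finset.sum_nonneg fun _ _ => sq_nonneg _)
    have hlp : (0 : ℝ) < (l : ℝ) ^ (2 * m) := by positivity
    refine le_of_mul_le_mul_right (hle.trans ?_) hlp
    rw [mul_right_comm s]
    exact mul_le_mul_of_nonneg_right hs hpos.le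
  simpa using this

theorem le_card_eigenvalues_Dop {N m : ℕ} (hm : 0 < m) (hN : m < N)
    (hH : ((Dop N m)ᵀ * Dop N m).IsHermitian) {u : ℝ} (hu : 0 ≤ u) (hu2 : u ≤ 2) :
    1 / (8 * (m + 1) ^ 2) * (N * u) ≤
      ((Finset.univ.filter fun i => hH.eigenvalues i ≤ u ^ (2 * m)).card : ℝ) := by
  have hone := one_le_card_eigenvalues_Dop hm hN hH (s := u ^ (2 * m)) (by positivity)
  have hm1 : (1 : ℝ) ≤ m := by exact_mod_cast hm
  rcases hu.eq_or_lt with rfl | hpos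
  · simp
  set l := ⌈2 * (m + 1) / u⌉₊ with hl
  have hlge : 2 * (m + 1) ≤ l * u := (div_le_iff₀ hpos).1 (Nat.le_ceil _)
  have hlle : l * u ≤ 4 * (m + 1) := by
    have := (Nat.ceil_lt_add_one (a := 2 * (m + 1) / u) (by positivity)).le
    calc l * u ≤ (2 * (m + 1) / u + 1) * u := by gcongr
      _ = 2 * (m + 1) + u := by field_simp
      _ ≤ _ := by linarith
  have hl0 : 0 < l := Nat.ceil_pos.2 (by positivity)
  have hR := le_card_eigenvalues_Dop_of_le hN.le hH hl0 (Nat.div_mul_le_self N ((m + 1) * l))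
    (s := u ^ (2 * m)) (by
      rw [← mul_pow, mul_comm u]
      calc (4 : ℝ) ^ m * (m + 1) ^ 2 ≤ 4 ^ m * (m + 1) ^ (2 * m) := by
            gcongr
            · linarith
            · omega
        _ = (2 * (m + 1)) ^ (2 * m) := by rw [mul_pow, pow_mul 2]; norm_num
        _ ≤ _ := by gcongr)
  set c := (Finset.univ.filter fun i => hH.eigenvalues i ≤ u ^ (2 * m)).card
  have hlt : N < ((m + 1) * l) * (2 * c) := by
    have h1 : 0 < (m + 1) * l := by positivity
    exact (Nat.lt_mul_div_succ N h1).trans_le (Nat.mul_le_mul_left _ (by omega))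
  have hlt' : (N : ℝ) ≤ ((m + 1) * l) * (2 * c) := by exact_mod_cast hlt.le
  rw [one_div, inv_mul_le_iff₀ (by positivity)]
  calc (N : ℝ) * u ≤ ((m + 1) * l) * (2 * c) * u := by gcongr
    _ = (m + 1) * (2 * c) * (l * u) := by ring
    _ ≤ (m + 1) * (2 * c) * (4 * (m + 1)) := by gcongr
    _ = _ := by ring

theorem eigenvalues_Dop_nonneg {N m : ℕ} (hH : ((Dop N m)ᵀ * Dop N m).IsHermitian) (i : Fin N) :
    0 ≤ hH.eigenvalues i := by
  obtain ⟨e, he⟩ := hH.exists_diagonalizing_coordinates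
  have h := (he (Pi.single i 1)).2
  simp only [Pi.single_apply, ite_pow, one_pow, ne_eq, OfNat.ofNat_ne_zero, not_false_eq_true,
    zero_pow, mul_ite, mul_one, mul_zero, Finset.sum_ite_eq', Finset.mem_univ, if_true] at h
  rw [← h]
  exact Finset.sum_nonneg fun _ _ => mul_self_nonneg _

theorem eigenvalues_Dop_le {N m : ℕ} (hH : ((Dop N m)ᵀ * Dop N m).IsHermitian) (i : Fin N) :
    hH.eigenvalues i ≤ 4 ^ m := by
  obtain ⟨e, he⟩ := hH.exists_diagonalizing_coordinates
  obtain ⟨h1, h2⟩ := he (Pi.single i 1)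
  simp only [Pi.single_apply, ite_pow, one_pow, ne_eq, OfNat.ofNat_ne_zero, not_false_eq_true,
    zero_pow, mul_ite, mul_one, mul_zero, Finset.sum_ite_eq', Finset.mem_univ, if_true] at h1 h2
  obtain ⟨f, hf⟩ := exists_nat_extension (e (Pi.single i 1))
  rw [hf, dotProduct_self_eq_sum_range] at h1
  rw [hf, Dop_mulVec_dotProduct_self] at h2
  simpa [← h2, h1] using sum_sq_fwdDiff_iterate_le f N m

theorem card_filter_le_pow_le {ι : Type*} [Fintype ι] (d : ℕ) {ρ : ι → ℝ}
    {t : ℝ} (hd : 1 ≤ d) :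
    (Finset.univ.filter fun i => ρ i ≤ t / d).card ^ d ≤
      (Finset.univ.filter fun i : Fin d → ι => ∑ j, ρ (i j) ≤ t).card := by
  classical
  rw [← Fintype.card_piFinset_const]
  refine Finset.card_le_card fun i hi => ?_
  have hd' : (0 : ℝ) < d := by exact_mod_cast hd
  simp only [Fintype.mem_piFinset, Finset.mem_filter, Finset.mem_univ, true_and] at hi ⊢
  calc ∑ j, ρ (i j) ≤ ∑ _j : Fin d, t / d := Finset.sum_le_sum fun j _ => hi j
    _ = t := by simp; field_simp

theorem card_filter_sum_le_le_pow {ι : Type*} [Fintype ι] (d : ℕ) {ρ : ι → ℝ}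
    (hρ : ∀ i, 0 ≤ ρ i) {t : ℝ} :
    (Finset.univ.filter fun i : Fin d → ι => ∑ j, ρ (i j) ≤ t).card ≤
      (Finset.univ.filter fun i => ρ i ≤ t).card ^ d := by
  classical
  rw [← Fintype.card_piFinset_const]
  refine Finset.card_le_card fun i hi => ?_
  simp only [Fintype.mem_piFinset, Finset.mem_filter, Finset.mem_univ, true_and] at hi ⊢
  exact fun j => (Finset.single_le_sum (f := fun j => ρ (i j)) (fun j _ => hρ _)
    (Finset.mem_univ j)).trans hi

theorem rpow_inv_two_mul_pow {m : ℕ} (hm : 0 < m) {s : ℝ} (hs : 0 ≤ s) :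
    (s ^ (1 / (2 * m : ℝ))) ^ (2 * m) = s := by
  rw [← Real.rpow_natCast, ← Real.rpow_mul hs]
  have : (m : ℝ) ≠ 0 := by positivity
  push_cast
  rw [one_div_mul_cancel (by positivity), Real.rpow_one]

theorem rpow_inv_two_mul_pow_eq (m d : ℕ) {s : ℝ} (hs : 0 ≤ s) :
    (s ^ (1 / (2 * m : ℝ))) ^ d = s ^ ((d : ℝ) / (2 * m)) := by
  rw [← Real.rpow_natCast, ← Real.rpow_mul hs]
  congr 1
  ring

/-- Lemma: spectral counting function of the KTF Gram matrix.
Let `ρ_1 ≤ ⋯ ≤ ρ_N` be the increasingly ordered eigenvalues of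
`(D_N^{(k+1)})ᵀ D_N^{(k+1)}` and `ξ_i = ρ_{i_1} + ⋯ + ρ_{i_d}` for `i ∈ {1,…,N}^d`.
With `F(t) = (1/n)·#{i : ξ_i ≤ t}`, there are constants `c₁,c₂,c₃ > 0` depending only
on `k,d` such that `c₁ t^{d/(2k+2)} ≤ F(t) ≤ c₂/n + c₃ t^{d/(2k+2)}` for all
`t ∈ [0, max_i ξ_i]`. -/
theorem ktf_spectral_counting (k d : ℕ) (hd : 1 ≤ d) :
    ∃ c₁ c₂ c₃ : ℝ, 0 < c₁ ∧ 0 < c₂ ∧ 0 < c₃ ∧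
      ∀ N : ℕ, k + 1 < N →
      ∀ (hH : ((Dop N (k + 1))ᵀ * Dop N (k + 1)).IsHermitian) (ρ : Fin N → ℝ),
        Monotone ρ →
        (∃ σ : Equiv.Perm (Fin N), ∀ i, ρ i = hH.eigenvalues (σ i)) →
        ∀ t : ℝ, 0 ≤ t → (∃ i : Fin d → Fin N, t ≤ ∑ j, ρ (i j)) →
          c₁ * t ^ ((d : ℝ) / (2 * k + 2)) ≤
              ((Finset.univ.filter (fun i : Fin d → Fin N => ∑ j, ρ (i j) ≤ t)).card : ℝ) /
                (N ^ d : ℕ) ∧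
            ((Finset.univ.filter (fun i : Fin d → Fin N => ∑ j, ρ (i j) ≤ t)).card : ℝ) /
                (N ^ d : ℕ) ≤
              c₂ / (N ^ d : ℕ) + c₃ * t ^ ((d : ℝ) / (2 * k + 2)) := by
  set m := k + 1 with hm
  have hm0 : 0 < m := by omega
  have hexp : (2 * k + 2 : ℝ) = 2 * (m : ℝ) := by rw [hm]; push_cast; ring
  have hd0 : (0 : ℝ) < d := by exact_mod_cast hd
  rw [hexp]
  refine ⟨(1 / (8 * (m + 1) ^ 2)) ^ d / (d : ℝ) ^ ((d : ℝ) / (2 * m)), 2 ^ (d - 1) * (m : ℝ) ^ d,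
    2 ^ (d - 1) * (2 * m : ℝ) ^ d, by positivity, by positivity, by positivity, ?_⟩
  rintro N hN hH ρ - ⟨σ, hσ⟩ t ht ⟨i, hi⟩
  have hNd : (0 : ℝ) < (N ^ d : ℕ) := by
    have : 0 < N := by omega
    positivity
  have hcard : ∀ s, (Finset.univ.filter fun i => ρ i ≤ s).card =
      (Finset.univ.filter fun i => hH.eigenvalues i ≤ s).card := fun s =>
    Finset.card_equiv σ fun i => by simp [hσ]
  constructor
  · rw [le_div_iff₀ hNd]
    have htd : 0 ≤ t / d := by positivity
    set u := (t / d) ^ (1 / (2 * m : ℝ)) with hu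
    have hu0 : 0 ≤ u := by positivity
    have hupow : u ^ (2 * m) = t / d := rpow_inv_two_mul_pow hm0 htd
    have hu2 : u ≤ 2 := by
      refine le_of_pow_le_pow_left₀ (n := 2 * m) (by omega) (by norm_num) ?_
      rw [hupow, pow_mul, div_le_iff₀ hd0]
      calc t ≤ ∑ j, ρ (i j) := hi
        _ ≤ ∑ _j : Fin d, (4 : ℝ) ^ m := Finset.sum_le_sum fun j _ => by
            rw [hσ]; exact eigenvalues_Dop_le hH _
        _ = _ := by simp; norm_num [mul_comm]
    have h := le_card_eigenvalues_Dop hm0 hN hH hu0 hu2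
    rw [hupow, ← hcard] at h
    calc _ = (1 / (8 * (m + 1) ^ 2) * (N * u)) ^ d := by
          rw [mul_pow, mul_pow, hu, rpow_inv_two_mul_pow_eq _ _ htd, Real.div_rpow ht hd0.le]
          push_cast
          ring
      _ ≤ ((Finset.univ.filter fun i => ρ i ≤ t / d).card : ℝ) ^ d := by gcongr
      _ ≤ _ := by exact_mod_cast card_filter_le_pow_le d hd
  · rw [div_le_iff₀ hNd, add_mul, div_mul_cancel₀ _ hNd.ne']
    set u := t ^ (1 / (2 * m : ℝ)) with hu
    have hu0 : 0 ≤ u := by positivity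
    have h := card_eigenvalues_Dop_le hm0 hH hu0
    rw [rpow_inv_two_mul_pow hm0 ht, ← hcard] at h
    have hρ : ∀ i, 0 ≤ ρ i := fun i => by rw [hσ]; exact eigenvalues_Dop_nonneg hH _
    calc _ ≤ ((Finset.univ.filter fun i => ρ i ≤ t).card : ℝ) ^ d := by
          exact_mod_cast card_filter_sum_le_le_pow d hρ
      _ ≤ (m + 2 * m * N * u) ^ d := by gcongr
      _ ≤ 2 ^ (d - 1) * ((m : ℝ) ^ d + (2 * m * N * u) ^ d) :=
          add_pow_le (by positivity) (by positivity) d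
      _ = _ := by
          rw [mul_pow _ u, hu, rpow_inv_two_mul_pow_eq _ _ ht, mul_pow _ (N : ℝ)]
          push_cast
          ring
end
end

section
/- Let k ≥ 0, d ≥ 1 be integers with 2(k+1) = d, N > k+1, n = N^d. Let ρ_1 ≤ ⋯ ≤ ρ_N be the increasingly ordered eigenvalues of (D_N^{(k+1)})ᵀ D_N^{(k+1)}, and for i ∈ {1,…,N}^d set ξ_i = ρ_{i_1} + ⋯ + ρ_{i_d}. There exists a constant c > 0 depending only on k and d such that for every a > 0: Σ_{i ∈ {1,…,N}^d} 1/(ξ_i + a) ≥ c n log( 1 + π^{2k+2} / a ). -/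
open scoped BigOperators ENNReal NNReal
open MeasureTheory ProbabilityTheory Matrix

noncomputable section

/-- Jensen's inequality for `x ↦ (x + a)⁻¹`, averaged over a product grid with respect to a doubly
stochastic matrix in each coordinate. -/
lemma sum_inv_add_le_of_doublyStochastic {ι : Type*} [Fintype ι] [DecidableEq ι] (d : ℕ)
    (P : ι → ι → ℝ) (hP : ∀ i l, 0 ≤ P i l) (hrow : ∀ i, ∑ l, P i l = 1)
    (hcol : ∀ l, ∑ i, P i l = 1) (μ : ι → ℝ) (hμ : ∀ l, 0 ≤ μ l) {a : ℝ} (ha : 0 < a) :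
    ∑ i : Fin d → ι, ((∑ j, ∑ l, P (i j) l * μ l) + a)⁻¹ ≤
      ∑ i : Fin d → ι, ((∑ j, μ (i j)) + a)⁻¹ := by
  have hw_row (i : Fin d → ι) : ∑ l : Fin d → ι, ∏ j, P (i j) (l j) = 1 := by
    rw [← Fintype.piFinset_univ, ← Finset.prod_univ_sum]
    simp [hrow]
  have hw_col (l : Fin d → ι) : ∑ i : Fin d → ι, ∏ j, P (i j) (l j) = 1 := by
    rw [← Fintype.piFinset_univ, ← Finset.prod_univ_sum (f := fun j x => P x (l j))]
    simp [hcol]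
  have hmarg (i : Fin d → ι) (j₀ : Fin d) :
      ∑ l : Fin d → ι, (∏ j, P (i j) (l j)) * μ (l j₀) = ∑ l, P (i j₀) l * μ l := by
    have h1 (l : Fin d → ι) : (∏ j, P (i j) (l j)) * μ (l j₀) =
        ∏ j, P (i j) (l j) * (if j = j₀ then μ (l j) else 1) := by
      rw [Finset.prod_mul_distrib, Finset.prod_ite_eq' Finset.univ j₀]
      simp
    rw [Finset.sum_congr rfl fun l _ => h1 l, ← Fintype.piFinset_univ,
      ← Finset.prod_univ_sum (f := fun j x => P (i j) x * (if j = j₀ then μ x else 1)),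
      Finset.prod_eq_single j₀]
    · simp
    · intro j _ hj
      simp [hj, hrow]
    · simp
  have hmean (i : Fin d → ι) :
      ∑ l : Fin d → ι, (∏ j, P (i j) (l j)) * ((∑ j, μ (l j)) + a) =
        (∑ j, ∑ l, P (i j) l * μ l) + a := by
    simp_rw [mul_add, Finset.sum_add_distrib, Finset.mul_sum]
    rw [Finset.sum_comm, ← Finset.sum_mul, hw_row, one_mul]
    simp_rw [hmarg]
  have hjensen (i : Fin d → ι) : ((∑ j, ∑ l, P (i j) l * μ l) + a)⁻¹ ≤
      ∑ l : Fin d → ι, (∏ j, P (i j) (l j)) * ((∑ j, μ (l j)) + a)⁻¹ := by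
    have hconv : ConvexOn ℝ (Set.Ioi (0 : ℝ)) fun x : ℝ => x⁻¹ := by
      simpa using convexOn_zpow (𝕜 := ℝ) (-1)
    have := hconv.map_sum_le (t := Finset.univ) (w := fun l : Fin d → ι => ∏ j, P (i j) (l j))
      (p := fun l => (∑ j, μ (l j)) + a)
      (fun l _ => Finset.prod_nonneg fun j _ => hP _ _) (hw_row i)
      (fun l _ => add_pos_of_nonneg_of_pos (Finset.sum_nonneg fun j _ => hμ _) ha)
    simpa only [smul_eq_mul, hmean] using this
  refine (Finset.sum_le_sum fun i _ => hjensen i).trans_eq ?_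
  rw [Finset.sum_comm]
  simp_rw [← Finset.sum_mul, hw_col, one_mul]

/-- Logarithmic lower bound for the sum of `(B ∑ⱼ (iⱼ / N) ^ d + a)⁻¹` over the `d`-dimensional
grid: comparison with an integral over the level sets of the maximal coordinate. -/
lemma log_le_sum_grid_inv {d N : ℕ} (hd : 1 ≤ d) (hN : 0 < N) {B a : ℝ} (hB : 0 < B)
    (ha : 0 < a) :
    (N ^ d : ℝ) / (d * B) * Real.log (1 + d * B / a) ≤
      ∑ i : Fin d → Fin N, ((∑ j, B * ((i j : ℕ) / N : ℝ) ^ d) + a)⁻¹ := by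
  have hd0 : (0 : ℝ) < d := by exact_mod_cast hd
  have hN0 : (0 : ℝ) < N := by exact_mod_cast hN
  set C : ℝ := d * B / N ^ d with hC
  have hCpos : 0 < C := by positivity
  set w : (Fin d → Fin N) → ℝ := fun i => ((∑ j, B * ((i j : ℕ) / N : ℝ) ^ d) + a)⁻¹ with hw
  let S : ℕ → Finset (Fin d → Fin N) := fun M =>
    Fintype.piFinset fun _ => Finset.univ.filter fun x : Fin N => (x : ℕ) < M
  have hcard {M : ℕ} (hM : M ≤ N) : (S M).card = M ^ d := by
    simp [S, Fintype.card_piFinset, Fin.card_filter_val_lt, hM]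
  have hmono (M : ℕ) : S M ⊆ S (M + 1) :=
    Fintype.piFinset_subset _ _ fun _ x hx => by
      simp only [Finset.mem_filter, Finset.mem_univ, true_and] at hx ⊢
      omega
  have hlower {M : ℕ} {i : Fin d → Fin N} (hi : i ∈ S (M + 1)) : (C * M ^ d + a)⁻¹ ≤ w i := by
    have hsum : ∑ j, B * ((i j : ℕ) / N : ℝ) ^ d ≤ C * M ^ d := by
      calc ∑ j, B * ((i j : ℕ) / N : ℝ) ^ d ≤ ∑ _j : Fin d, B * ((M : ℝ) / N) ^ d := by
            refine Finset.sum_le_sum fun j _ => ?_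
            have : ((i j : ℕ) : ℝ) ≤ M := by
              have := Fintype.mem_piFinset.1 hi j
              simp only [Finset.mem_filter, Finset.mem_univ, true_and] at this
              exact_mod_cast Nat.lt_succ_iff.1 this
            gcongr
        _ = C * M ^ d := by
            simp only [Finset.sum_const, Finset.card_univ, Fintype.card_fin, nsmul_eq_mul, hC,
              div_pow]
            ring
    have : 0 ≤ ∑ j, B * ((i j : ℕ) / N : ℝ) ^ d := Finset.sum_nonneg fun j _ => by positivity
    simp only [hw]
    gcongr
  have key : ∀ M ≤ N, C⁻¹ * (Real.log (C * M ^ d + a) - Real.log a) ≤ ∑ i ∈ S M, w i := by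
    intro M
    induction M with
    | zero =>
      intro _
      have : S 0 = ∅ := Finset.card_eq_zero.1 (by rw [hcard (Nat.zero_le _)]; simp; omega)
      simp [this, show d ≠ 0 by omega]
    | succ M ih =>
      intro hM
      have hx : 0 < C * (M : ℝ) ^ d + a := by positivity
      have hy : 0 < C * ((M + 1 : ℕ) : ℝ) ^ d + a := by positivity
      have hcard' : (((S (M + 1) \ S M).card : ℕ) : ℝ) = ((M + 1 : ℕ) : ℝ) ^ d - (M : ℝ) ^ d := by
        rw [Finset.card_sdiff_of_subset (hmono M), hcard hM, hcard (by omega),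
          Nat.cast_sub (Nat.pow_le_pow_left (by omega) d)]
        push_cast
        rfl
      have hlog : Real.log (C * ((M + 1 : ℕ) : ℝ) ^ d + a) - Real.log (C * (M : ℝ) ^ d + a) ≤
          C * (((M + 1 : ℕ) : ℝ) ^ d - (M : ℝ) ^ d) * (C * (M : ℝ) ^ d + a)⁻¹ := by
        rw [← Real.log_div hy.ne' hx.ne']
        refine (Real.log_le_sub_one_of_pos (div_pos hy hx)).trans_eq ?_
        field_simp
        ring
      have hlayer : (((M + 1 : ℕ) : ℝ) ^ d - (M : ℝ) ^ d) * (C * (M : ℝ) ^ d + a)⁻¹ ≤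
          ∑ i ∈ S (M + 1) \ S M, w i := by
        rw [← hcard', ← nsmul_eq_mul]
        exact Finset.card_nsmul_le_sum _ _ _ fun i hi => hlower (Finset.sdiff_subset hi)
      rw [← Finset.sum_sdiff (hmono M)]
      have h1 := ih (by omega)
      have h2 := mul_le_mul_of_nonneg_left hlog (inv_pos.2 hCpos).le
      rw [← mul_assoc, ← mul_assoc, inv_mul_cancel₀ hCpos.ne', one_mul] at h2
      linarith
  have hfin := key N le_rfl
  have hS : S N = Finset.univ := by simp [S]
  rw [hS, ← Real.log_div (by positivity) ha.ne'] at hfin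
  convert hfin using 2
  · rw [hC, inv_div]
  · congr 1
    rw [hC]
    field_simp
    ring

lemma sum_D1_mul {M : ℕ} (i : Fin (M - 1)) (f : ℕ → ℂ) :
    ∑ j : Fin M, (D1 M i j : ℂ) * f j = f (i + 1) - f i := by
  let g : ℕ → ℂ := fun n =>
    (if (i : ℕ) + 1 = n then f n else 0) - (if (i : ℕ) = n then f n else 0)
  have h (j : Fin M) : (D1 M i j : ℂ) * f j = g j := by
    simp only [D1, Matrix.of_apply, g]
    split_ifs <;> first | omega | simp
  have hi := i.isLt
  rw [Finset.sum_congr rfl fun j _ => h j, Fin.sum_univ_eq_sum_range g, Finset.sum_sub_distrib,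
    Finset.sum_ite_eq, Finset.sum_ite_eq, if_pos (by simp; omega), if_pos (by simp; omega)]

lemma sum_Dop_mul_pow (N m : ℕ) (z : ℂ) (i : Fin (N - m)) :
    ∑ j : Fin N, (Dop N m i j : ℂ) * z ^ (j : ℕ) = (z - 1) ^ m * z ^ (i : ℕ) := by
  induction m with
  | zero =>
    let g : ℕ → ℂ := fun n => if (i : ℕ) = n then z ^ n else 0
    have h (j : Fin N) : (Dop N 0 i j : ℂ) * z ^ (j : ℕ) = g j := by
      simp only [Dop, Matrix.of_apply, g]
      split_ifs <;> simp
    rw [Finset.sum_congr rfl fun j _ => h j, Fin.sum_univ_eq_sum_range g, Finset.sum_ite_eq,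
      if_pos (by simp)]
    simp
  | succ m ih =>
    have h : ∀ j : Fin N, (Dop N (m + 1) i j : ℂ) * z ^ (j : ℕ) =
        ∑ l : Fin (N - m), (D1 (N - m) i l : ℂ) * ((Dop N m l j : ℂ) * z ^ (j : ℕ)) := fun j => by
      simp only [Dop, Matrix.mul_apply, Complex.ofReal_sum, Complex.ofReal_mul, Finset.sum_mul,
        mul_assoc]
    rw [Finset.sum_congr rfl fun j _ => h j, Finset.sum_comm]
    simp_rw [← Finset.mul_sum, ih]
    refine (sum_D1_mul (M := N - m) i fun n => (z - 1) ^ m * z ^ n).trans ?_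
    ring

/-- The unitary discrete Fourier matrix. -/
def fourierMatrix (N : ℕ) : Matrix (Fin N) (Fin N) ℂ :=
  Matrix.of fun x j =>
    (Complex.exp (2 * Real.pi * Complex.I / N) ^ (j : ℕ)) ^ (x : ℕ) / (Real.sqrt N : ℂ)

lemma norm_exp_two_pi_div_pow (N j : ℕ) :
    ‖Complex.exp (2 * Real.pi * Complex.I / N) ^ j‖ = 1 := by
  rw [norm_pow, show (2 * Real.pi * Complex.I / N : ℂ) = ((2 * Real.pi / N : ℝ) : ℂ) * Complex.I by
    push_cast; ring, Complex.norm_exp_ofReal_mul_I, one_pow]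

lemma norm_exp_two_pi_div_pow_sub_one_le (N j : ℕ) :
    ‖Complex.exp (2 * Real.pi * Complex.I / N) ^ j - 1‖ ≤ 2 * Real.pi * (j / N) := by
  rw [← Complex.exp_nat_mul, show (j * (2 * Real.pi * Complex.I / N) : ℂ) =
    Complex.I * ((2 * Real.pi * (j / N) : ℝ) : ℂ) by push_cast; ring]
  refine Real.norm_exp_I_mul_ofReal_sub_one_le.trans_eq (Real.norm_of_nonneg ?_)
  have := Real.pi_pos
  positivity

lemma fourierMatrix_conjTranspose_mul_self {N : ℕ} (hN : 0 < N) :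
    (fourierMatrix N)ᴴ * fourierMatrix N = 1 := by
  have hN0 : (N : ℂ) ≠ 0 := by exact_mod_cast hN.ne'
  have hζ := Complex.isPrimitiveRoot_exp N hN.ne'
  have hsq : (Real.sqrt N : ℂ) * (Real.sqrt N : ℂ) = N := by
    rw [← Complex.ofReal_mul, Real.mul_self_sqrt N.cast_nonneg, Complex.ofReal_natCast]
  ext j l
  set ζ := Complex.exp (2 * Real.pi * Complex.I / N) with hζdef
  have hconj : (starRingEnd ℂ) (ζ ^ (j : ℕ)) = (ζ ^ (j : ℕ))⁻¹ :=
    (Complex.inv_eq_conj (norm_exp_two_pi_div_pow N j)).symm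
  have hentry : ((fourierMatrix N)ᴴ * fourierMatrix N) j l =
      (∑ x ∈ Finset.range N, (ζ ^ (l : ℕ) / ζ ^ (j : ℕ)) ^ x) / N := by
    rw [Matrix.mul_apply, ← Fin.sum_univ_eq_sum_range, Finset.sum_div]
    refine Finset.sum_congr rfl fun x _ => ?_
    simp only [fourierMatrix, Matrix.conjTranspose_apply, Matrix.of_apply, ← hζdef]
    rw [star_div₀, star_pow]
    simp only [RCLike.star_def, Complex.conj_ofReal, hconj]
    rw [div_mul_div_comm, hsq, div_pow, inv_pow]
    ring
  rw [hentry]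
  have hz : ζ ≠ 0 := Complex.exp_ne_zero _
  by_cases hjl : j = l
  · subst hjl
    simp [hz, hN0]
  · rw [Matrix.one_apply_ne hjl]
    have hne : ζ ^ (l : ℕ) / ζ ^ (j : ℕ) ≠ 1 := by
      intro h
      rw [div_eq_one_iff_eq (pow_ne_zero _ hz)] at h
      exact hjl (Fin.ext (hζ.pow_inj j.isLt l.isLt h.symm))
    rw [geom_sum_eq hne, div_pow, ← pow_mul, ← pow_mul, mul_comm _ N, mul_comm _ N, pow_mul,
      pow_mul, hζ.pow_eq_one]
    simp

/-- The Rayleigh quotients of the difference Gram matrix at the Fourier vectors. -/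
lemma sum_norm_sq_Dop_fourierMatrix_le {N : ℕ} (hN : 0 < N) (m : ℕ) (j : Fin N) :
    ∑ x, ‖((Dop N m).map Complex.ofReal * fourierMatrix N) x j‖ ^ 2 ≤
      (2 * Real.pi * ((j : ℕ) / N)) ^ (2 * m) := by
  have hN0 : (0 : ℝ) < N := by exact_mod_cast hN
  set z := Complex.exp (2 * Real.pi * Complex.I / N) ^ (j : ℕ) with hz
  have hentry (x : Fin (N - m)) : ((Dop N m).map Complex.ofReal * fourierMatrix N) x j =
      (z - 1) ^ m * z ^ (x : ℕ) / (Real.sqrt N : ℂ) := by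
    rw [← sum_Dop_mul_pow, Finset.sum_div, Matrix.mul_apply]
    simp only [fourierMatrix, Matrix.of_apply, Matrix.map_apply, ← hz, ← mul_div_assoc]
  have hnorm (x : Fin (N - m)) :
      ‖((Dop N m).map Complex.ofReal * fourierMatrix N) x j‖ ^ 2 = ‖z - 1‖ ^ (2 * m) / N := by
    rw [hentry, norm_div, norm_mul, norm_pow, norm_pow, norm_exp_two_pi_div_pow, one_pow, mul_one,
      Complex.norm_real, Real.norm_of_nonneg (Real.sqrt_nonneg _), div_pow,
      Real.sq_sqrt N.cast_nonneg, ← pow_mul, mul_comm m]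
  rw [Finset.sum_congr rfl fun x _ => hnorm x, Finset.sum_const, Finset.card_univ,
    Fintype.card_fin, nsmul_eq_mul]
  calc ((N - m : ℕ) : ℝ) * (‖z - 1‖ ^ (2 * m) / N) ≤ N * (‖z - 1‖ ^ (2 * m) / N) := by
        gcongr
        omega
    _ = ‖z - 1‖ ^ (2 * m) := by field_simp
    _ ≤ _ := by
        gcongr
        exact norm_exp_two_pi_div_pow_sub_one_le N j

lemma conjTranspose_map_ofReal {α β : Type*} (A : Matrix α β ℝ) :
    (A.map Complex.ofReal)ᴴ = Aᵀ.map Complex.ofReal := by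
  ext
  simp

lemma map_ofReal_mul {α β γ : Type*} [Fintype β] (A : Matrix α β ℝ) (B : Matrix β γ ℝ) :
    (A * B).map Complex.ofReal = A.map Complex.ofReal * B.map Complex.ofReal :=
  Matrix.map_mul (f := Complex.ofRealHom)

/-- The Rayleigh quotients at the columns of a unitary matrix `W` are averages of the eigenvalues
with respect to a doubly stochastic matrix. -/
lemma exists_doublyStochastic_rayleigh {ι κ : Type*} [Fintype ι] [DecidableEq ι] [Fintype κ]
    (D : Matrix κ ι ℝ) (hH : (Dᵀ * D).IsHermitian) (W : Matrix ι ι ℂ) (hW : Wᴴ * W = 1) :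
    ∃ P : ι → ι → ℝ, (∀ i l, 0 ≤ P i l) ∧ (∀ i, ∑ l, P i l = 1) ∧ (∀ l, ∑ i, P i l = 1) ∧
      ∀ i, ∑ l, P i l * hH.eigenvalues l = ∑ x, ‖(D.map Complex.ofReal * W) x i‖ ^ 2 := by
  set U : Matrix ι ι ℝ := hH.eigenvectorUnitary.1
  have hU1 : U * Uᵀ = 1 := by
    have := Unitary.mul_star_self_of_mem hH.eigenvectorUnitary.2
    rwa [Matrix.star_eq_conjTranspose, Matrix.conjTranspose_eq_transpose_of_trivial] at this
  have hspec : Dᵀ * D = U * Matrix.diagonal hH.eigenvalues * Uᵀ := by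
    have := hH.spectral_theorem
    rw [Unitary.conjStarAlgAut_apply, Matrix.star_eq_conjTranspose,
      Matrix.conjTranspose_eq_transpose_of_trivial] at this
    exact this
  set V : Matrix ι ι ℂ := U.map Complex.ofReal with hV
  have hV1 : V * Vᴴ = 1 := by
    rw [hV, conjTranspose_map_ofReal, ← map_ofReal_mul, hU1]
    exact Matrix.map_one _ Complex.ofReal_zero Complex.ofReal_one
  set Q : Matrix ι ι ℂ := Wᴴ * V with hQ
  have hQ1 : Q * Qᴴ = 1 := by
    rw [hQ, Matrix.conjTranspose_mul, Matrix.conjTranspose_conjTranspose, Matrix.mul_assoc,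
      ← Matrix.mul_assoc V, hV1, Matrix.one_mul, hW]
  have hQ2 : Qᴴ * Q = 1 := mul_eq_one_comm.1 hQ1
  have hgram : Q * (Matrix.diagonal hH.eigenvalues).map Complex.ofReal * Qᴴ =
      (D.map Complex.ofReal * W)ᴴ * (D.map Complex.ofReal * W) := by
    have : (D.map Complex.ofReal)ᴴ * D.map Complex.ofReal =
        V * (Matrix.diagonal hH.eigenvalues).map Complex.ofReal * Vᴴ := by
      rw [conjTranspose_map_ofReal, hV, conjTranspose_map_ofReal, ← map_ofReal_mul, ← map_ofReal_mul, ← map_ofReal_mul]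
      exact congrArg (fun A => A.map Complex.ofReal) hspec
    have h : (D.map Complex.ofReal * W)ᴴ * (D.map Complex.ofReal * W) =
        Wᴴ * ((D.map Complex.ofReal)ᴴ * D.map Complex.ofReal) * W := by
      simp only [Matrix.conjTranspose_mul, Matrix.mul_assoc]
    rw [h, this, hQ, Matrix.conjTranspose_mul, Matrix.conjTranspose_conjTranspose]
    simp only [Matrix.mul_assoc]
  have hnormsq (z : ℂ) : ((‖z‖ ^ 2 : ℝ) : ℂ) = z * star z := by
    rw [RCLike.star_def, Complex.mul_conj, Complex.normSq_eq_norm_sq]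
  refine ⟨fun i l => ‖Q i l‖ ^ 2, fun i l => by positivity, fun i => ?_, fun l => ?_,
    fun i => ?_⟩
  · have := congrFun (congrFun hQ1 i) i
    rw [Matrix.mul_apply, Matrix.one_apply_eq] at this
    apply Complex.ofReal_injective
    rw [Complex.ofReal_sum, Complex.ofReal_one, ← this]
    simp only [hnormsq, Matrix.conjTranspose_apply]
  · have := congrFun (congrFun hQ2 l) l
    rw [Matrix.mul_apply, Matrix.one_apply_eq] at this
    apply Complex.ofReal_injective
    rw [Complex.ofReal_sum, Complex.ofReal_one, ← this]
    simp only [hnormsq, Matrix.conjTranspose_apply, mul_comm]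
  · have := congrFun (congrFun hgram i) i
    apply Complex.ofReal_injective
    rw [Matrix.diagonal_map Complex.ofReal_zero, Matrix.mul_apply, Matrix.mul_apply] at this
    simp only [Matrix.mul_diagonal, Matrix.conjTranspose_apply] at this
    simp only [Complex.ofReal_sum, Complex.ofReal_mul, hnormsq]
    rw [Finset.sum_congr rfl fun x _ => mul_comm ((D.map Complex.ofReal * W) x i) _, ← this]
    exact Finset.sum_congr rfl fun x _ => mul_right_comm _ _ _

/-- Lemma: lower bound on the regularized inverse-eigenvalue sum in
the boundary case `2(k+1) = d`.  Let `ρ_1 ≤ ⋯ ≤ ρ_N` be the increasingly ordered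
eigenvalues of `(D_N^{(k+1)})ᵀ D_N^{(k+1)}` and `ξ_i = ρ_{i_1} + ⋯ + ρ_{i_d}`.  There
is `c > 0` depending only on `k, d` such that for every `a > 0`,
`Σ_{i ∈ {1,…,N}^d} 1/(ξ_i + a) ≥ c n log(1 + π^{2k+2}/a)`. -/
theorem ktf_regularized_inverse_eigenvalue_sum (k d : ℕ) (hd : 1 ≤ d)
    (hkd : 2 * (k + 1) = d) :
    ∃ c : ℝ, 0 < c ∧ ∀ N : ℕ, k + 1 < N →
      ∀ (hH : ((Dop N (k + 1))ᵀ * Dop N (k + 1)).IsHermitian) (ρ : Fin N → ℝ),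
        Monotone ρ →
        (∃ σ : Equiv.Perm (Fin N), ∀ i, ρ i = hH.eigenvalues (σ i)) →
        ∀ a : ℝ, 0 < a →
          c * (N ^ d : ℕ) * Real.log (1 + Real.pi ^ (2 * k + 2) / a) ≤
            ∑ i : Fin d → Fin N, ((∑ j, ρ (i j)) + a)⁻¹ := by
  have hπ := Real.pi_pos
  have hd0 : (0 : ℝ) < d := by exact_mod_cast hd
  set B : ℝ := (2 * Real.pi) ^ d with hB
  have hBpos : 0 < B := by positivity
  refine ⟨1 / (d * B), by positivity, ?_⟩
  rintro N hN hH ρ - ⟨σ, hσ⟩ a ha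
  have hN0 : 0 < N := by omega
  obtain ⟨P, hP, hrow, hcol, hray⟩ := exists_doublyStochastic_rayleigh _ hH (fourierMatrix N)
    (fourierMatrix_conjTranspose_mul_self hN0)
  have hnonneg (l : Fin N) : 0 ≤ hH.eigenvalues l :=
    Matrix.eigenvalues_conjTranspose_mul_self_nonneg (Dop N (k + 1)) l
  have hbound (i : Fin N) :
      ∑ l, P i l * hH.eigenvalues l ≤ B * ((i : ℕ) / N : ℝ) ^ d := by
    rw [hray, hB, ← mul_pow, ← hkd]
    exact sum_norm_sq_Dop_fourierMatrix_le hN0 (k + 1) i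
  calc 1 / (d * B) * (N ^ d : ℕ) * Real.log (1 + Real.pi ^ (2 * k + 2) / a)
      ≤ (N ^ d : ℝ) / (d * B) * Real.log (1 + d * B / a) := by
        rw [show 2 * k + 2 = d by omega, Nat.cast_pow, one_div_mul_eq_div]
        have h1 : Real.pi ^ d ≤ B := pow_le_pow_left₀ hπ.le (by linarith) d
        have h2 : (1 : ℝ) ≤ d := by exact_mod_cast hd
        have : Real.pi ^ d ≤ d * B := h1.trans (le_mul_of_one_le_left hBpos.le h2)
        gcongr
    _ ≤ ∑ i : Fin d → Fin N, ((∑ j, B * ((i j : ℕ) / N : ℝ) ^ d) + a)⁻¹ :=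
        log_le_sum_grid_inv hd hN0 hBpos ha
    _ ≤ ∑ i : Fin d → Fin N, ((∑ j, ∑ l, P (i j) l * hH.eigenvalues l) + a)⁻¹ := by
        refine Finset.sum_le_sum fun i _ => ?_
        have : 0 ≤ ∑ j, ∑ l, P (i j) l * hH.eigenvalues l := Finset.sum_nonneg fun j _ =>
          Finset.sum_nonneg fun l _ => mul_nonneg (hP _ _) (hnonneg l)
        gcongr with j
        exact hbound _
    _ ≤ ∑ i : Fin d → Fin N, ((∑ j, hH.eigenvalues (i j)) + a)⁻¹ :=
        sum_inv_add_le_of_doublyStochastic d P hP hrow hcol _ hnonneg ha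
    _ = ∑ i : Fin d → Fin N, ((∑ j, ρ (i j)) + a)⁻¹ := by
        rw [← Equiv.sum_comp (Equiv.piCongrRight fun _ : Fin d => σ)]
        simp [hσ]
end
end
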